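/- Let Λ be the limit set of a CIFS on ℝ^d with fixed point set F, and let ψ be the associated threshold function. Then lim_{r→0} ( log N_r(Λ)/log(1/r) − ψ(r) ) = 0. In particular, dim_LB Λ = liminf_{r→0} ψ(r). -/

import Mathlib

open Set Metric Filter Topology MeasureTheory

noncomputable section

/-- Least number of open balls of radius `r` needed to cover `E`. -/
def coveringNumber {α : Type*} [PseudoMetricSpace α] (E : Set α) (r : ℝ) : ℕ :=
  sInf {n : ℕ | ∃ t : Finset α, t.card = n ∧ E ⊆ ⋃ x ∈ t, Metric.ball x r}

/-- `s_E(r) = log N_r(E) / log (1/r)`. -/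
def sFun {α : Type*} [PseudoMetricSpace α] (E : Set α) (r : ℝ) : ℝ :=
  Real.log (coveringNumber E r) / Real.log (1 / r)

/-- Lower box dimension. -/
def dimLB {α : Type*} [PseudoMetricSpace α] (E : Set α) : ℝ :=
  Filter.liminf (fun r => sFun E r) (nhdsWithin (0 : ℝ) (Set.Ioi 0))

/-- Upper box dimension. -/
def dimUB {α : Type*} [PseudoMetricSpace α] (E : Set α) : ℝ :=
  Filter.limsup (fun r => sFun E r) (nhdsWithin (0 : ℝ) (Set.Ioi 0))

/-- Upper right Dini derivative. -/
def upperDini (g : ℝ → ℝ) (x : ℝ) : ℝ :=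
  Filter.limsup (fun h => (g (x + h) - g x) / h) (nhdsWithin (0 : ℝ) (Set.Ioi 0))

/-- The class `𝒢(λ, α)`. -/
def GClass (lam alp : ℝ) : Set (ℝ → ℝ) :=
  {g | Continuous g ∧ (∀ x, g x ∈ Set.Icc lam alp) ∧
    ∀ x, upperDini g x ∈ Set.Icc (lam - g x) (alp - g x)}

/-- Asymptotic equivalence of two functions. -/
def AsympEquiv (f g : ℝ → ℝ) : Prop :=
  Filter.Tendsto (fun x => f x - g x) Filter.atTop (nhds 0)

/-- `E` has covering class `g`. -/
def HasCoveringClass {α : Type*} [PseudoMetricSpace α] (E : Set α) (g : ℝ → ℝ) : Prop :=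
  AsympEquiv (fun x => sFun E (Real.exp (-Real.exp x))) g

/-- Composition of the maps indexed by a finite word. -/
def compMaps {α : Type*} {I : Type*} (T : I → α → α) : List I → α → α
  | [] => id
  | i :: w => T i ∘ compMaps T w

/-- A conformal iterated function system on `ℝ^d` satisfying the open set condition
and the cone condition. -/
structure CIFS (d : ℕ) where
  /-- the compact seed set -/
  X : Set (EuclideanSpace ℝ (Fin d))
  /-- the countable index set -/
  I : Type
  /-- the contractions -/
  S : I → EuclideanSpace ℝ (Fin d) → EuclideanSpace ℝ (Fin d)
  hXcompact : IsCompact X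
  hXconn : IsConnected X
  hXint : (interior X).Nonempty
  hIcount : Countable I
  hInonempty : Nonempty I
  hSmaps : ∀ i, Set.MapsTo (S i) X X
  /-- the uniform contraction ratio -/
  c : ℝ
  hc0 : 0 < c
  hc1 : c < 1
  hcontr : ∀ i, ∀ x ∈ X, ∀ y ∈ X,
    (x ≠ y → 0 < dist (S i x) (S i y)) ∧ dist (S i x) (S i y) ≤ c * dist x y
  /-- the open connected set on which the maps extend conformally -/
  V : Set (EuclideanSpace ℝ (Fin d))
  hVopen : IsOpen V
  hVbdd : Bornology.IsBounded V
  hVconn : IsConnected V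
  hXV : X ⊆ V
  /-- the conformal extensions -/
  T : I → EuclideanSpace ℝ (Fin d) → EuclideanSpace ℝ (Fin d)
  hTagree : ∀ i, ∀ x ∈ X, T i x = S i x
  hTmaps : ∀ i, Set.MapsTo (T i) V V
  hTinj : ∀ i, Set.InjOn (T i) V
  /-- the Hölder exponent in `C^{1+ε}` -/
  eps : ℝ
  heps : 0 < eps
  hTdiff : ∀ i, ContDiffOn ℝ 1 (T i) V
  hTholder : ∀ i, ∃ C : ℝ, 0 < C ∧ ∀ x ∈ V, ∀ y ∈ V,
    ‖fderiv ℝ (T i) x - fderiv ℝ (T i) y‖ ≤ C * ‖x - y‖ ^ eps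
  hTconf : ∀ i, ∀ x ∈ V, IsConformalMap (fderiv ℝ (T i) x)
  /-- the bounded distortion constant -/
  K : ℝ
  hK : 1 ≤ K
  hBD : ∀ w : List I, ∀ x ∈ V, ∀ y ∈ V,
    ‖fderiv ℝ (compMaps T w) x‖ ≤ K * ‖fderiv ℝ (compMaps T w) y‖
  hOSCin : ∀ i, S i '' interior X ⊆ interior X
  hOSCdisj : ∀ i j, i ≠ j → Disjoint (S i '' interior X) (S j '' interior X)
  hCone : ∃ κ : ℝ, 0 < κ ∧ ∀ x ∈ X, ∀ r : ℝ, 0 < r → r < 1 →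
    ENNReal.ofReal (κ * r ^ d) ≤ volume (Metric.ball x r ∩ interior X)

/-- The limit set (attractor) of a CIFS. -/
def CIFS.limitSet {d : ℕ} (Φ : CIFS d) : Set (EuclideanSpace ℝ (Fin d)) :=
  ⋃ γ : ℕ → Φ.I, ⋂ n : ℕ, compMaps Φ.S (List.ofFn fun k : Fin (n + 1) => γ k) '' Φ.X

/-- The set of fixed points of the maps of a CIFS. -/
def CIFS.fixedPoints {d : ℕ} (Φ : CIFS d) : Set (EuclideanSpace ℝ (Fin d)) :=
  {x | x ∈ Φ.X ∧ ∃ i, Φ.S i x = x}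

/-- `ρ(w) = sup_{x ∈ X} ‖S'_w(x)‖`. -/
def CIFS.rho {d : ℕ} (Φ : CIFS d) (w : List Φ.I) : ℝ :=
  sSup ((fun x => ‖fderiv ℝ (compMaps Φ.T w) x‖) '' Φ.X)

/-- `Ψ(r, θ) = (1 - θ)·dim_H Λ + θ·s_F(r^θ)`. -/
def CIFS.Psi {d : ℕ} (Φ : CIFS d) (r θ : ℝ) : ℝ :=
  (1 - θ) * (dimH Φ.limitSet).toReal + θ * sFun Φ.fixedPoints (r ^ θ)

/-- `ψ(r) = max_{θ ∈ [0,1]} Ψ(r,θ)` (which equals the supremum over `θ ∈ (0,1]`,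
since `Ψ(r,0)` is defined as the limit of `Ψ(r,θ)` as `θ → 0⁺`). -/
def CIFS.psi {d : ℕ} (Φ : CIFS d) (r : ℝ) : ℝ :=
  sSup (Φ.Psi r '' Set.Ioc (0 : ℝ) 1)

/-- The interval `𝒟(h, s, t, α)`. -/
def Dset (h s t α : ℝ) : Set ℝ :=
  if t ≤ h then {h}
  else Set.Icc (max h s) (h + (t - h) * (α - h) * s / (α * t - h * s))

/-- The quantity whose limit as `θ → 1⁻` is the quasi-Assouad dimension. -/
def quasiAssouadAux {α : Type*} [PseudoMetricSpace α] (E : Set α) (θ : ℝ) : ℝ :=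
  sInf {t : ℝ | 0 ≤ t ∧ ∃ C : ℝ, 0 < C ∧ ∀ x ∈ E, ∀ r R : ℝ,
    0 < r → r ≤ R ^ (1 / θ) → R ^ (1 / θ) ≤ R → R < 1 →
    (coveringNumber (E ∩ Metric.ball x R) r : ℝ) ≤ C * (R / r) ^ t}

/-- The quasi-Assouad dimension. -/
def dimqA {α : Type*} [PseudoMetricSpace α] (E : Set α) : ℝ :=
  Filter.limsup (quasiAssouadAux E) (nhdsWithin (1 : ℝ) (Set.Iio 1))

/-- The modified lower box dimension. -/
def dimLMB {α : Type*} [PseudoMetricSpace α] (K : Set α) : ℝ :=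
  sInf {s : ℝ | ∃ C : ℕ → Set α, (K ⊆ ⋃ i, C i) ∧
    (∀ i, (C i).Nonempty ∧ Bornology.IsBounded (C i)) ∧ s = ⨆ i, dimLB (C i)}

/-- The unit cube `[0,1]^d`. -/
def unitCube (d : ℕ) : Set (EuclideanSpace ℝ (Fin d)) :=
  {x | ∀ j, x j ∈ Set.Icc (0 : ℝ) 1}

/-- The basic similarity maps in the homogeneous Moran construction. -/
def moranMap (d : ℕ) (r : ℝ) (i : Fin d → Bool)
    (x : EuclideanSpace ℝ (Fin d)) : EuclideanSpace ℝ (Fin d) :=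
  (EuclideanSpace.equiv (Fin d) ℝ).symm (fun j => r * x j + (if i j then 1 - r else 0))

/-- The `n`-th level of the homogeneous Moran construction. -/
def moranLevel (d : ℕ) : (ℕ → ℝ) → ℕ → Set (EuclideanSpace ℝ (Fin d))
  | _, 0 => unitCube d
  | r, n + 1 => ⋃ i : Fin d → Bool, moranMap d (r 1) i '' moranLevel d (fun k => r (k + 1)) n

/-- The homogeneous Moran set `M(r)`. -/
def moranSet (d : ℕ) (r : ℕ → ℝ) : Set (EuclideanSpace ℝ (Fin d)) :=
  ⋂ n, moranLevel d r (n + 1)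

/-- The Gauss map `x ↦ 1/x - ⌊1/x⌋`. -/
def gaussMap (x : ℝ) : ℝ := Int.fract (1 / x)

/-- The `n`-th partial quotient (continued fraction digit) of `x` (`n = 0` gives `b₁ = ⌊1/x⌋`). -/
def cfDigit (x : ℝ) (n : ℕ) : ℤ := ⌊1 / gaussMap^[n] x⌋

/-- The set of irrationals in `(0,1)` all of whose continued fraction digits lie in `I`. -/
def cfSet (I : Set ℕ) : Set ℝ :=
  {x | x ∈ Set.Ioo (0 : ℝ) 1 ∧ Irrational x ∧ ∀ n : ℕ, ∃ b ∈ I, cfDigit x n = (b : ℤ)}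


section CoveringNumber

variable {α : Type*} [PseudoMetricSpace α]

theorem coveringNumber_le_card {E : Set α} {r : ℝ} (t : Finset α)
    (h : E ⊆ ⋃ x ∈ t, ball x r) : _root_.coveringNumber E r ≤ t.card :=
  Nat.sInf_le ⟨t, rfl, h⟩

theorem exists_cover_card_eq_coveringNumber {E : Set α} (hE : TotallyBounded E) {r : ℝ}
    (hr : 0 < r) :
    ∃ t : Finset α, t.card = _root_.coveringNumber E r ∧ E ⊆ ⋃ x ∈ t, ball x r := by
  have hne : {n : ℕ | ∃ t : Finset α, t.card = n ∧ E ⊆ ⋃ x ∈ t, ball x r}.Nonempty := by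
    obtain ⟨t, ht, hcov⟩ := Metric.totallyBounded_iff.1 hE r hr
    exact ⟨_, ht.toFinset, rfl, by simpa using hcov⟩
  exact Nat.sInf_mem hne

theorem coveringNumber_anti {E : Set α} (hE : TotallyBounded E) {r s : ℝ} (hr : 0 < r)
    (hrs : r ≤ s) : _root_.coveringNumber E s ≤ _root_.coveringNumber E r := by
  obtain ⟨t, ht, hcov⟩ := exists_cover_card_eq_coveringNumber hE hr
  rw [← ht]
  exact coveringNumber_le_card t (hcov.trans (iUnion₂_mono fun x _ => ball_subset_ball hrs))

theorem one_le_coveringNumber {E : Set α} (hE : TotallyBounded E) (hne : E.Nonempty) {r : ℝ}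
    (hr : 0 < r) : 1 ≤ _root_.coveringNumber E r := by
  obtain ⟨t, ht, hcov⟩ := exists_cover_card_eq_coveringNumber hE hr
  obtain ⟨x, hx⟩ := hne
  obtain ⟨y, hy, -⟩ := mem_iUnion₂.1 (hcov hx)
  rw [← ht]
  exact Finset.card_pos.2 ⟨y, hy⟩

/-- A totally bounded set contains a maximal `r`-separated finite subset, which is then an
`r`-net. -/
theorem exists_separated_card_ge {E : Set α} (hE : TotallyBounded E) {r : ℝ} (hr : 0 < r) :
    ∃ P : Finset α, (P : Set α) ⊆ E ∧ (P : Set α).Pairwise (fun x y => r ≤ dist x y) ∧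
      _root_.coveringNumber E r ≤ P.card := by
  classical
  obtain ⟨t, ht, hcov⟩ := exists_cover_card_eq_coveringNumber hE (half_pos hr)
  have hbound : ∀ P : Finset α, (P : Set α) ⊆ E →
      (P : Set α).Pairwise (fun x y => r ≤ dist x y) → P.card ≤ t.card := by
    intro P hPE hP
    have h1 : ∀ p ∈ P, ∃ y ∈ t, p ∈ ball y (r / 2) := fun p hp => by
      simpa using hcov (hPE hp)
    choose! f hft hf using h1
    refine Finset.card_le_card_of_injOn f hft ?_
    intro p hp q hq hpq
    by_contra hne
    have h2 := hP hp hq hne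
    have h3 := hf p hp
    have h4 := hf q hq
    rw [← hpq] at h4
    have := dist_triangle_right p q (f p)
    simp only [mem_ball] at h3 h4
    linarith
  let Q : ℕ → Prop := fun n => ∃ P : Finset α, (P : Set α) ⊆ E ∧
    (P : Set α).Pairwise (fun x y => r ≤ dist x y) ∧ P.card = n
  have hQ0 : Q 0 := ⟨∅, by simp, by simp, rfl⟩
  obtain ⟨P, hPE, hP, hcard⟩ : Q (Nat.findGreatest Q t.card) :=
    Nat.findGreatest_spec (Nat.zero_le _) hQ0
  refine ⟨P, hPE, hP, coveringNumber_le_card P fun x hx => ?_⟩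
  by_contra hcon
  simp only [mem_iUnion, mem_ball, not_exists, not_lt] at hcon
  have hxP : x ∉ P := fun h => by simpa using hr.trans_le (hcon x h)
  have hsep : ((insert x P : Finset α) : Set α).Pairwise (fun x y => r ≤ dist x y) := by
    rw [Finset.coe_insert]
    refine hP.insert fun y hy _ => ⟨hcon y hy, ?_⟩
    rw [dist_comm]
    exact hcon y hy
  have hsub : ((insert x P : Finset α) : Set α) ⊆ E := by
    rw [Finset.coe_insert]
    exact insert_subset hx hPE
  have h5 : Q (P.card + 1) := ⟨insert x P, hsub, hsep, Finset.card_insert_of_notMem hxP⟩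
  have h6 : P.card + 1 ≤ t.card := by
    have := hbound _ hsub hsep
    rwa [Finset.card_insert_of_notMem hxP] at this
  have := Nat.le_findGreatest h6 h5
  omega

/-- Covering numbers at comparable scales in a finite-dimensional normed space are comparable. -/
theorem exists_coveringNumber_le_mul {V : Type*} [NormedAddCommGroup V] [NormedSpace ℝ V]
    [ProperSpace V] (C : ℝ) :
    ∃ m : ℕ, ∀ E : Set V, TotallyBounded E → ∀ r : ℝ, 0 < r → 0 < C →
      _root_.coveringNumber E r ≤ m * _root_.coveringNumber E (C * r) := by
  classical
  have htb : TotallyBounded (ball (0 : V) C) :=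
    (isCompact_closedBall (0 : V) C).totallyBounded.subset ball_subset_closedBall
  obtain ⟨t, -, htc⟩ := exists_cover_card_eq_coveringNumber htb one_pos
  refine ⟨t.card, fun E hE r hr hC => ?_⟩
  obtain ⟨u, hu, hcov⟩ := exists_cover_card_eq_coveringNumber hE (mul_pos hC hr)
  have := coveringNumber_le_card (E := E) (r := r)
    (Finset.image (fun p : V × V => p.2 + r • p.1) (t ×ˢ u)) (fun x hx => ?_)
  · calc _ ≤ _ := this
      _ ≤ (t ×ˢ u).card := Finset.card_image_le
      _ = _ := by rw [Finset.card_product, hu]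
  · obtain ⟨z, hz, hxz⟩ := mem_iUnion₂.1 (hcov hx)
    have h1 : r⁻¹ • (x - z) ∈ ball (0 : V) C := by
      rw [mem_ball_zero_iff, norm_smul, norm_inv, Real.norm_of_nonneg hr.le, inv_mul_lt_iff₀ hr,
        ← dist_eq_norm, mul_comm]
      exact hxz
    obtain ⟨y, hy, hxy⟩ := mem_iUnion₂.1 (htc h1)
    refine mem_iUnion₂.2 ⟨z + r • y,
      Finset.mem_image.2 ⟨(y, z), Finset.mk_mem_product hy hz, rfl⟩, ?_⟩
    rw [mem_ball, dist_eq_norm] at hxy ⊢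
    have h2 : x - (z + r • y) = r • (r⁻¹ • (x - z) - y) := by
      rw [smul_sub, smul_inv_smul₀ hr.ne']
      abel
    rw [h2, norm_smul, Real.norm_of_nonneg hr.le]
    nlinarith

end CoveringNumber

section Conformal

variable {V W : Type*} [NormedAddCommGroup V] [NormedSpace ℝ V] [NormedAddCommGroup W]
  [NormedSpace ℝ W]

theorem IsConformalMap.norm_comp [Nontrivial V] {f : V →L[ℝ] V} (hf : IsConformalMap f)
    (g : W →L[ℝ] V) : ‖f.comp g‖ = ‖f‖ * ‖g‖ := by
  obtain ⟨c, -, li, rfl⟩ := hf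
  rw [ContinuousLinearMap.smul_comp, norm_smul, norm_smul,
    LinearIsometry.norm_toContinuousLinearMap_comp, LinearIsometry.norm_toContinuousLinearMap,
    mul_one]

theorem IsConformalMap.abs_det {V : Type*} [NormedAddCommGroup V] [InnerProductSpace ℝ V]
    [FiniteDimensional ℝ V] [Nontrivial V] {f : V →L[ℝ] V}
    (hf : IsConformalMap f) : |f.det| = ‖f‖ ^ Module.finrank ℝ V := by
  obtain ⟨c, -, li, rfl⟩ := hf
  rw [norm_smul, LinearIsometry.norm_toContinuousLinearMap, mul_one, Real.norm_eq_abs]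
  have h1 : |LinearMap.det (li.toLinearMap)| = 1 := by
    rw [← Real.norm_eq_abs, ← LinearMap.normDet_eq_norm_det, li.normDet_eq_one]
  change |LinearMap.det (c • li.toLinearMap)| = _
  rw [LinearMap.det_smul, abs_mul, h1, abs_pow, mul_one]

end Conformal

section CompMaps

variable {α I : Type*} (T : I → α → α)

theorem compMaps_append (u v : List I) :
    compMaps T (u ++ v) = compMaps T u ∘ compMaps T v := by
  induction u with
  | nil => rfl
  | cons i u ih => rw [List.cons_append, compMaps, ih, compMaps, Function.comp_assoc]

variable {T}

theorem compMaps_mapsTo {s : Set α} (h : ∀ i, MapsTo (T i) s s) (w : List I) :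
    MapsTo (compMaps T w) s s := by
  induction w with
  | nil => exact mapsTo_id s
  | cons i w ih => exact (h i).comp ih

theorem compMaps_injOn {s : Set α} (h : ∀ i, MapsTo (T i) s s) (hinj : ∀ i, InjOn (T i) s)
    (w : List I) : InjOn (compMaps T w) s := by
  induction w with
  | nil => exact injOn_id s
  | cons i w ih => exact (hinj i).comp ih (compMaps_mapsTo h w)

theorem compMaps_eqOn {S : I → α → α} {s : Set α} (h : ∀ i, MapsTo (S i) s s)
    (heq : ∀ i, EqOn (T i) (S i) s) (w : List I) : EqOn (compMaps T w) (compMaps S w) s := by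
  induction w with
  | nil => exact fun _ _ => rfl
  | cons i w ih =>
    intro x hx
    simp only [compMaps, Function.comp_apply]
    rw [ih hx]
    exact heq i (compMaps_mapsTo h w hx)

/-- Distinct words of the same length give disjoint images of an open set witnessing the open
set condition. -/
theorem compMaps_disjoint {s : Set α} (h : ∀ i, MapsTo (T i) s s) (hinj : ∀ i, InjOn (T i) s)
    (hdisj : ∀ i j, i ≠ j → Disjoint (T i '' s) (T j '' s)) {u v : List I}
    (hlen : u.length = v.length) (hne : u ≠ v) :
    Disjoint (compMaps T u '' s) (compMaps T v '' s) := by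
  induction u generalizing v with
  | nil => exact absurd (List.length_eq_zero_iff.1 hlen.symm).symm hne
  | cons i u ih =>
    cases v with
    | nil => simp at hlen
    | cons j v =>
      simp only [compMaps, image_comp]
      by_cases hij : i = j
      · subst hij
        refine disjoint_image_image ?_
        have huv := ih (v := v) (by simpa using hlen) (fun h => hne (by rw [h]))
        rintro a ⟨x, hx, rfl⟩ b ⟨y, hy, rfl⟩ hab
        have := hinj i (compMaps_mapsTo h u hx) (compMaps_mapsTo h v hy) hab
        exact huv.ne_of_mem (mem_image_of_mem _ hx) (mem_image_of_mem _ hy) this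
      · exact (hdisj i j hij).mono (image_mono (compMaps_mapsTo h u).image_subset)
          (image_mono (compMaps_mapsTo h v).image_subset)

end CompMaps

namespace CIFS

variable {d : ℕ} (Φ : CIFS d)

/-- A point in the interior of the seed set. -/
def basePoint : EuclideanSpace ℝ (Fin d) := Φ.hXint.some

/-- The norm of the derivative of `S_w` at the base point. -/
def size (w : List Φ.I) : ℝ := ‖fderiv ℝ (compMaps Φ.T w) Φ.basePoint‖

theorem basePoint_mem_interior : Φ.basePoint ∈ interior Φ.X := Φ.hXint.some_mem

theorem basePoint_mem : Φ.basePoint ∈ Φ.X := interior_subset Φ.basePoint_mem_interior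

theorem basePoint_mem_V : Φ.basePoint ∈ Φ.V := Φ.hXV Φ.basePoint_mem

theorem compMaps_T_eqOn (w : List Φ.I) : EqOn (compMaps Φ.T w) (compMaps Φ.S w) Φ.X :=
  compMaps_eqOn Φ.hSmaps (fun i x hx => Φ.hTagree i x hx) w

theorem compMaps_S_mapsTo (w : List Φ.I) : MapsTo (compMaps Φ.S w) Φ.X Φ.X :=
  compMaps_mapsTo Φ.hSmaps w

theorem compMaps_T_mapsTo (w : List Φ.I) : MapsTo (compMaps Φ.T w) Φ.V Φ.V :=
  compMaps_mapsTo Φ.hTmaps w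

theorem compMaps_T_injOn (w : List Φ.I) : InjOn (compMaps Φ.T w) Φ.V :=
  compMaps_injOn Φ.hTmaps Φ.hTinj w

theorem interior_subset_V : interior Φ.X ⊆ Φ.V := interior_subset.trans Φ.hXV

theorem T_image_interior (i : Φ.I) : Φ.T i '' interior Φ.X = Φ.S i '' interior Φ.X :=
  image_congr fun x hx => Φ.hTagree i x (interior_subset hx)

theorem T_mapsTo_interior (i : Φ.I) : MapsTo (Φ.T i) (interior Φ.X) (interior Φ.X) := by
  rw [mapsTo_iff_image_subset, Φ.T_image_interior]
  exact Φ.hOSCin i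

theorem compMaps_T_mapsTo_interior (w : List Φ.I) :
    MapsTo (compMaps Φ.T w) (interior Φ.X) (interior Φ.X) :=
  compMaps_mapsTo Φ.T_mapsTo_interior w

theorem compMaps_T_disjoint {u v : List Φ.I} (hlen : u.length = v.length) (hne : u ≠ v) :
    Disjoint (compMaps Φ.T u '' interior Φ.X) (compMaps Φ.T v '' interior Φ.X) :=
  compMaps_disjoint Φ.T_mapsTo_interior (fun i => (Φ.hTinj i).mono Φ.interior_subset_V)
    (fun i j hij => by rw [Φ.T_image_interior, Φ.T_image_interior]; exact Φ.hOSCdisj i j hij)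
    hlen hne

theorem differentiableAt_T (i : Φ.I) {x : EuclideanSpace ℝ (Fin d)} (hx : x ∈ Φ.V) :
    DifferentiableAt ℝ (Φ.T i) x :=
  ((Φ.hTdiff i).differentiableOn one_ne_zero).differentiableAt (Φ.hVopen.mem_nhds hx)

theorem differentiableAt_compMaps (w : List Φ.I) {x : EuclideanSpace ℝ (Fin d)} (hx : x ∈ Φ.V) :
    DifferentiableAt ℝ (compMaps Φ.T w) x := by
  induction w with
  | nil => exact differentiableAt_id
  | cons i w ih => exact (Φ.differentiableAt_T i (Φ.compMaps_T_mapsTo w hx)).comp x ih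

theorem isConformalMap_fderiv (w : List Φ.I) {x : EuclideanSpace ℝ (Fin d)} (hx : x ∈ Φ.V) :
    IsConformalMap (fderiv ℝ (compMaps Φ.T w) x) := by
  induction w with
  | nil =>
    simp only [compMaps, fderiv_id]
    exact isConformalMap_id
  | cons i w ih =>
    have hwx := Φ.compMaps_T_mapsTo w hx
    rw [compMaps, fderiv_comp x (Φ.differentiableAt_T i hwx) (Φ.differentiableAt_compMaps w hx)]
    exact (Φ.hTconf i _ hwx).comp ih

theorem dist_compMaps_le (w : List Φ.I) {x y : EuclideanSpace ℝ (Fin d)} (hx : x ∈ Φ.X)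
    (hy : y ∈ Φ.X) :
    dist (compMaps Φ.S w x) (compMaps Φ.S w y) ≤ Φ.c ^ w.length * dist x y := by
  induction w with
  | nil => simp [compMaps]
  | cons i w ih =>
    calc _ ≤ Φ.c * dist (compMaps Φ.S w x) (compMaps Φ.S w y) :=
          (Φ.hcontr i _ (Φ.compMaps_S_mapsTo w hx) _ (Φ.compMaps_S_mapsTo w hy)).2
      _ ≤ Φ.c * (Φ.c ^ w.length * dist x y) := mul_le_mul_of_nonneg_left ih Φ.hc0.le
      _ = _ := by rw [List.length_cons]; ring

theorem norm_fderiv_le (w : List Φ.I) {x : EuclideanSpace ℝ (Fin d)} (hx : x ∈ Φ.V) :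
    ‖fderiv ℝ (compMaps Φ.T w) x‖ ≤ Φ.K * Φ.size w :=
  Φ.hBD w x hx _ Φ.basePoint_mem_V

theorem size_div_le_norm_fderiv (w : List Φ.I) {x : EuclideanSpace ℝ (Fin d)} (hx : x ∈ Φ.V) :
    Φ.size w / Φ.K ≤ ‖fderiv ℝ (compMaps Φ.T w) x‖ := by
  rw [div_le_iff₀' (zero_lt_one.trans_le Φ.hK)]
  exact Φ.hBD w _ Φ.basePoint_mem_V x hx

theorem K_pos : 0 < Φ.K := zero_lt_one.trans_le Φ.hK

theorem size_le_pow (w : List Φ.I) : Φ.size w ≤ Φ.c ^ w.length := by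
  refine norm_fderiv_le_of_lip' ℝ (pow_nonneg Φ.hc0.le _) ?_
  filter_upwards [mem_interior_iff_mem_nhds.1 Φ.basePoint_mem_interior] with x hx
  rw [Φ.compMaps_T_eqOn w hx, Φ.compMaps_T_eqOn w Φ.basePoint_mem, ← dist_eq_norm, ← dist_eq_norm]
  exact Φ.dist_compMaps_le w hx Φ.basePoint_mem

theorem size_le_one (w : List Φ.I) : Φ.size w ≤ 1 :=
  (Φ.size_le_pow w).trans (pow_le_one₀ Φ.hc0.le Φ.hc1.le)

variable [NeZero d]

theorem size_pos (w : List Φ.I) : 0 < Φ.size w :=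
  norm_pos_iff.2 (Φ.isConformalMap_fderiv w Φ.basePoint_mem_V).ne_zero

theorem size_nil : Φ.size [] = 1 := by
  simp only [size, compMaps, fderiv_id]
  exact ContinuousLinearMap.norm_id

theorem size_append (u v : List Φ.I) :
    Φ.size (u ++ v) =
      ‖fderiv ℝ (compMaps Φ.T u) (compMaps Φ.T v Φ.basePoint)‖ * Φ.size v := by
  have hv := Φ.compMaps_T_mapsTo v Φ.basePoint_mem_V
  rw [size, compMaps_append, fderiv_comp _ (Φ.differentiableAt_compMaps u hv)
    (Φ.differentiableAt_compMaps v Φ.basePoint_mem_V), (Φ.isConformalMap_fderiv u hv).norm_comp,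
    size]

theorem le_size_append (u v : List Φ.I) :
    Φ.size u / Φ.K * Φ.size v ≤ Φ.size (u ++ v) := by
  rw [size_append]
  exact mul_le_mul_of_nonneg_right
    (Φ.size_div_le_norm_fderiv u (Φ.compMaps_T_mapsTo v Φ.basePoint_mem_V)) (Φ.size_pos v).le

/-- The maps `S_w` are Lipschitz with constant comparable to the norm of their derivative. -/
theorem exists_dist_compMaps_le :
    ∃ C : ℝ, 1 ≤ C ∧ ∀ (w : List Φ.I), ∀ x ∈ Φ.X, ∀ y ∈ Φ.X,
      dist (compMaps Φ.S w x) (compMaps Φ.S w y) ≤ C * Φ.size w * dist x y := by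
  obtain ⟨η, hη, hηV⟩ := Φ.hXcompact.exists_thickening_subset_open Φ.hVopen Φ.hXV
  have hlocal : ∀ w : List Φ.I, ∀ x ∈ Φ.X, ∀ y ∈ ball x η,
      dist (compMaps Φ.T w x) (compMaps Φ.T w y) ≤ Φ.K * Φ.size w * dist x y := by
    intro w x hx y hy
    have hball : ball x η ⊆ Φ.V := (ball_subset_thickening hx η).trans hηV
    rw [dist_comm, dist_comm x, dist_eq_norm, dist_eq_norm]
    exact (convex_ball x η).norm_image_sub_le_of_norm_fderiv_le
      (fun z hz => Φ.differentiableAt_compMaps w (hball hz))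
      (fun z hz => Φ.norm_fderiv_le w (hball hz)) (mem_ball_self hη) hy
  have hchain : ∀ x ∈ Φ.X, ∀ y ∈ Φ.X, ∃ C : ℝ, ∀ w : List Φ.I,
      dist (compMaps Φ.T w x) (compMaps Φ.T w y) ≤ C * Φ.size w := by
    intro x hx y hy
    refine Φ.hXconn.isPreconnected.induction₂ (fun x y => ∃ C : ℝ, ∀ w : List Φ.I,
      dist (compMaps Φ.T w x) (compMaps Φ.T w y) ≤ C * Φ.size w) ?_ ?_ ?_ hx hy
    · intro x hx
      filter_upwards [mem_nhdsWithin_of_mem_nhds (ball_mem_nhds x hη)] with y hy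
      refine ⟨Φ.K * η, fun w => (hlocal w x hx y hy).trans ?_⟩
      have h1 : dist x y ≤ η := by rw [dist_comm]; exact (mem_ball.1 hy).le
      calc _ ≤ Φ.K * Φ.size w * η :=
            mul_le_mul_of_nonneg_left h1 (mul_pos Φ.K_pos (Φ.size_pos w)).le
        _ = _ := by ring
    · rintro x y z - - - ⟨C, hC⟩ ⟨C', hC'⟩
      refine ⟨C + C', fun w => ?_⟩
      have := dist_triangle (compMaps Φ.T w x) (compMaps Φ.T w y) (compMaps Φ.T w z)
      linarith [hC w, hC' w]
    · rintro x y - - ⟨C, hC⟩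
      exact ⟨C, fun w => by rw [dist_comm]; exact hC w⟩
  have hdiam : ∃ C : ℝ, ∀ y ∈ Φ.X, ∀ w : List Φ.I,
      dist (compMaps Φ.T w Φ.basePoint) (compMaps Φ.T w y) ≤ C * Φ.size w := by
    refine Φ.hXcompact.induction_on (p := fun s => ∃ C : ℝ, ∀ y ∈ s, ∀ w : List Φ.I,
      dist (compMaps Φ.T w Φ.basePoint) (compMaps Φ.T w y) ≤ C * Φ.size w) ?_ ?_ ?_ ?_
    · exact ⟨0, by simp⟩
    · rintro s t hst ⟨C, hC⟩
      exact ⟨C, fun y hy => hC y (hst hy)⟩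
    · rintro s t ⟨C, hC⟩ ⟨C', hC'⟩
      refine ⟨max C C', fun y hy w => ?_⟩
      rcases hy with hy | hy
      · exact (hC y hy w).trans
          (mul_le_mul_of_nonneg_right (le_max_left _ _) (Φ.size_pos w).le)
      · exact (hC' y hy w).trans
          (mul_le_mul_of_nonneg_right (le_max_right _ _) (Φ.size_pos w).le)
    · intro x hx
      obtain ⟨C, hC⟩ := hchain _ Φ.basePoint_mem x hx
      refine ⟨ball x η, mem_nhdsWithin_of_mem_nhds (ball_mem_nhds x hη), C + Φ.K * η,
        fun y hy w => ?_⟩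
      have h1 : dist x y ≤ η := by rw [dist_comm]; exact (mem_ball.1 hy).le
      have h2 := hlocal w x hx y hy
      have h3 := mul_le_mul_of_nonneg_left h1 (mul_pos Φ.K_pos (Φ.size_pos w)).le
      have := dist_triangle (compMaps Φ.T w Φ.basePoint) (compMaps Φ.T w x) (compMaps Φ.T w y)
      linarith [hC w]
  obtain ⟨C, hC⟩ := hdiam
  refine ⟨max Φ.K (2 * C / η), Φ.hK.trans (le_max_left _ _), fun w x hx y hy => ?_⟩
  rw [← Φ.compMaps_T_eqOn w hx, ← Φ.compMaps_T_eqOn w hy]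
  have hw := Φ.size_pos w
  rcases lt_or_ge (dist y x) η with h | h
  · refine (hlocal w x hx y h).trans ?_
    gcongr
    exact le_max_left _ _
  · have h1 := hC x hx w
    have h2 := hC y hy w
    have h3 := dist_triangle_left (compMaps Φ.T w x) (compMaps Φ.T w y)
      (compMaps Φ.T w Φ.basePoint)
    have h4 : 0 ≤ C := by
      have := dist_nonneg.trans h1
      exact nonneg_of_mul_nonneg_left this hw
    rw [dist_comm] at h
    calc dist (compMaps Φ.T w x) (compMaps Φ.T w y) ≤ 2 * C / η * Φ.size w * η := by
          field_simp
          linarith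
      _ ≤ max Φ.K (2 * C / η) * Φ.size w * dist x y := by
          gcongr
          exact le_max_right _ _

end CIFS

namespace CIFS

variable {d : ℕ} [NeZero d] (Φ : CIFS d)

theorem le_volume_image (w : List Φ.I) {A : Set (EuclideanSpace ℝ (Fin d))}
    (hA : MeasurableSet A) (hAV : A ⊆ Φ.V) :
    ENNReal.ofReal ((Φ.size w / Φ.K) ^ d) * volume A ≤ volume (compMaps Φ.T w '' A) := by
  rw [← lintegral_abs_det_fderiv_eq_addHaar_image volume hA
    (fun x hx => (Φ.differentiableAt_compMaps w (hAV hx)).hasFDerivAt.hasFDerivWithinAt)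
    ((Φ.compMaps_T_injOn w).mono hAV), ← setLIntegral_const]
  refine setLIntegral_mono' hA fun x hx => ENNReal.ofReal_le_ofReal ?_
  rw [(Φ.isConformalMap_fderiv w (hAV hx)).abs_det, finrank_euclideanSpace_fin]
  exact pow_le_pow_left₀ (div_nonneg (Φ.size_pos w).le Φ.K_pos.le)
    (Φ.size_div_le_norm_fderiv w (hAV hx)) d

/-- Volume packing: only boundedly many images of small balls, of comparable size and pairwise
disjoint, can lie close to a given point. -/
theorem exists_card_le_of_pairwiseDisjoint {M : ℝ} (hM : 0 ≤ M) :
    ∃ C : ℝ, ∀ {ι : Type} (J : Finset ι) (w : ι → List Φ.I)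
      (x : ι → EuclideanSpace ℝ (Fin d)) (z : EuclideanSpace ℝ (Fin d)) (a : ℝ), 0 < a →
      (∀ j ∈ J, x j ∈ Φ.X) → (∀ j ∈ J, a < Φ.size (w j)) →
      (J : Set ι).PairwiseDisjoint
        (fun j => compMaps Φ.T (w j) '' (ball (x j) (a / Φ.size (w j)) ∩ interior Φ.X)) →
      (∀ j ∈ J, dist (compMaps Φ.S (w j) (x j)) z ≤ M * a) → (J.card : ℝ) ≤ C := by
  obtain ⟨κ, hκ, hcone⟩ := Φ.hCone
  obtain ⟨L, hL, hLip⟩ := Φ.exists_dist_compMaps_le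
  set v : ℝ := (volume (ball (0 : EuclideanSpace ℝ (Fin d)) 1)).toReal
  refine ⟨(M + L) ^ d * v * Φ.K ^ d / κ, ?_⟩
  intro ι J w x z a ha hx hw hdisj hz
  have hmeas : ∀ j, MeasurableSet (ball (x j) (a / Φ.size (w j)) ∩ interior Φ.X) := fun j =>
    measurableSet_ball.inter measurableSet_interior
  have hsubV : ∀ j, ball (x j) (a / Φ.size (w j)) ∩ interior Φ.X ⊆ Φ.V := fun j =>
    inter_subset_right.trans Φ.interior_subset_V
  have hlow : ∀ j ∈ J, ENNReal.ofReal (κ * a ^ d / Φ.K ^ d) ≤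
      volume (compMaps Φ.T (w j) '' (ball (x j) (a / Φ.size (w j)) ∩ interior Φ.X)) := by
    intro j hj
    have hs := Φ.size_pos (w j)
    refine le_trans ?_ (Φ.le_volume_image (w j) (hmeas j) (hsubV j))
    refine le_trans ?_ (mul_le_mul_right (hcone (x j) (hx j hj) (a / Φ.size (w j))
      (div_pos ha hs) ((div_lt_one hs).2 (hw j hj))) _)
    rw [← ENNReal.ofReal_mul (pow_nonneg (div_nonneg hs.le Φ.K_pos.le) d)]
    refine ENNReal.ofReal_le_ofReal (le_of_eq ?_)
    have := Φ.K_pos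
    rw [div_pow, div_pow]
    field_simp
  have hup : (⋃ j ∈ J, compMaps Φ.T (w j) '' (ball (x j) (a / Φ.size (w j)) ∩ interior Φ.X)) ⊆
      closedBall z ((M + L) * a) := by
    refine iUnion₂_subset fun j hj => ?_
    rintro _ ⟨y, ⟨hy, hyX⟩, rfl⟩
    have hs := Φ.size_pos (w j)
    rw [Φ.compMaps_T_eqOn (w j) (interior_subset hyX), mem_closedBall]
    have h1 := hLip (w j) y (interior_subset hyX) (x j) (hx j hj)
    have h2 : L * Φ.size (w j) * dist y (x j) ≤ L * a := by
      have : Φ.size (w j) * dist y (x j) ≤ a := by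
        rw [← le_div_iff₀' hs]
        exact (mem_ball.1 hy).le
      rw [mul_assoc]
      exact mul_le_mul_of_nonneg_left this (by linarith)
    have := dist_triangle (compMaps Φ.S (w j) y) (compMaps Φ.S (w j) (x j)) z
    linarith [hz j hj]
  have hvol : (J.card : ENNReal) * ENNReal.ofReal (κ * a ^ d / Φ.K ^ d) ≤
      ENNReal.ofReal (((M + L) * a) ^ d) * volume (ball (0 : EuclideanSpace ℝ (Fin d)) 1) := by
    calc _ ≤ ∑ j ∈ J, volume
          (compMaps Φ.T (w j) '' (ball (x j) (a / Φ.size (w j)) ∩ interior Φ.X)) := by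
          rw [← nsmul_eq_mul]
          exact Finset.card_nsmul_le_sum _ _ _ hlow
      _ = volume (⋃ j ∈ J,
          compMaps Φ.T (w j) '' (ball (x j) (a / Φ.size (w j)) ∩ interior Φ.X)) := by
          rw [measure_biUnion_finset hdisj]
          intro j _
          exact (hmeas j).image_of_continuousOn_injOn
            (fun y hy => (Φ.differentiableAt_compMaps (w j)
              (hsubV j hy)).continuousAt.continuousWithinAt)
            ((Φ.compMaps_T_injOn (w j)).mono (hsubV j))
      _ ≤ volume (closedBall z ((M + L) * a)) := measure_mono hup
      _ = _ := by
          rw [Measure.addHaar_closedBall _ _ (by positivity), finrank_euclideanSpace_fin]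
  have hK := Φ.K_pos
  have hreal := ENNReal.toReal_mono
    (ENNReal.mul_ne_top ENNReal.ofReal_ne_top measure_ball_lt_top.ne) hvol
  rw [ENNReal.toReal_mul, ENNReal.toReal_mul, ENNReal.toReal_natCast,
    ENNReal.toReal_ofReal (by positivity), ENNReal.toReal_ofReal (by positivity)] at hreal
  have had : 0 < a ^ d := pow_pos ha d
  rw [le_div_iff₀ hκ]
  rw [mul_pow] at hreal
  have hKd : 0 < Φ.K ^ d := pow_pos hK d
  have h3 : (J.card : ℝ) * κ * a ^ d ≤ (M + L) ^ d * v * Φ.K ^ d * a ^ d := by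
    calc (J.card : ℝ) * κ * a ^ d = J.card * (κ * a ^ d / Φ.K ^ d) * Φ.K ^ d := by field_simp
      _ ≤ ((M + L) ^ d * a ^ d * v) * Φ.K ^ d := mul_le_mul_of_nonneg_right hreal hKd.le
      _ = _ := by ring
  exact le_of_mul_le_mul_right h3 had

end CIFS

section MassDistribution

/-- Mass distribution principle along a geometric sequence of scales. -/
theorem natCast_le_rpow_dimH_of_measure_le {d : ℕ} {A : Set (EuclideanSpace ℝ (Fin d))}
    (μ : Measure (EuclideanSpace ℝ (Fin d))) (hμ : μ A ≠ 0) {C b : ℝ} (hC : 0 < C) (hb : 0 < b)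
    (hb1 : b < 1) {N : ℕ} (hN : 2 ≤ N)
    (h : ∀ (n : ℕ) (s : Set (EuclideanSpace ℝ (Fin d))), ediam s ≤ ENNReal.ofReal (b ^ n) →
      μ s ≤ ENNReal.ofReal (C * (1 / N) ^ n)) :
    (N : ℝ) ≤ (1 / b) ^ (dimH A).toReal := by
  have hN1 : (1 : ℝ) < N := by exact_mod_cast hN
  have hN0 : (0 : ℝ) < N := by linarith
  have hlogb : 0 < Real.log (1 / b) := Real.log_pos ((one_lt_div hb).2 hb1)
  have hsigma : 0 < Real.log N / Real.log (1 / b) := div_pos (Real.log_pos hN1) hlogb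
  set σ : NNReal := (Real.log N / Real.log (1 / b)).toNNReal with hσ
  have hσr : (σ : ℝ) = Real.log N / Real.log (1 / b) := Real.coe_toNNReal _ hsigma.le
  have hσ0 : 0 < (σ : ℝ) := hσr ▸ hsigma
  have hNb : (1 / b) ^ (σ : ℝ) = N := by
    rw [Real.rpow_def_of_pos (one_div_pos.2 hb), hσr, mul_div_cancel₀ _ hlogb.ne',
      Real.exp_log hN0]
  have hbN : b ^ (σ : ℝ) = 1 / N := by
    rw [← hNb, Real.div_rpow zero_le_one hb.le, Real.one_rpow, one_div_one_div]
  have hkey : ∀ s : Set (EuclideanSpace ℝ (Fin d)), ediam s ≤ 1 →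
      μ s ≤ ENNReal.ofReal (C * N) * ediam s ^ (σ : ℝ) := by
    intro s hs
    have hfin : ediam s ≠ ⊤ := (hs.trans_lt ENNReal.one_lt_top).ne
    obtain ⟨D, hD⟩ : ∃ D : ℝ, D = (ediam s).toReal := ⟨_, rfl⟩
    have hDs : ediam s = ENNReal.ofReal D := by rw [hD, ENNReal.ofReal_toReal hfin]
    have hD0 : 0 ≤ D := hD ▸ ENNReal.toReal_nonneg
    have hD1 : D ≤ 1 := by
      rw [hDs, ← ENNReal.ofReal_one] at hs
      exact (ENNReal.ofReal_le_ofReal_iff zero_le_one).1 hs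
    rcases hD0.eq_or_lt with h0 | hpos
    · have h1 : ∀ n : ℕ, μ s ≤ ENNReal.ofReal (C * (1 / N) ^ n) := fun n => h n s (by
        rw [hDs, ← h0]
        exact ENNReal.ofReal_le_ofReal (by positivity))
      have h2 : Tendsto (fun n : ℕ => ENNReal.ofReal (C * (1 / N) ^ n)) atTop (𝓝 0) := by
        have := (tendsto_pow_atTop_nhds_zero_of_lt_one (r := 1 / (N : ℝ)) (by positivity)
          ((div_lt_one hN0).2 hN1)).const_mul C
        rw [mul_zero] at this
        simpa using ENNReal.tendsto_ofReal this
      exact (ge_of_tendsto' h2 h1).trans zero_le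
    · obtain ⟨n, hn1, hn2⟩ := exists_nat_pow_near_of_lt_one hpos hD1 hb hb1
      refine (h n s (by rw [hDs]; exact ENNReal.ofReal_le_ofReal hn2)).trans ?_
      rw [hDs, ENNReal.ofReal_rpow_of_pos hpos, ← ENNReal.ofReal_mul (by positivity)]
      refine ENNReal.ofReal_le_ofReal ?_
      have h3 : (b ^ (n + 1)) ^ (σ : ℝ) ≤ D ^ (σ : ℝ) :=
        Real.rpow_le_rpow (by positivity) hn1.le hσ0.le
      rw [← Real.rpow_natCast, ← Real.rpow_mul hb.le, mul_comm, Real.rpow_mul hb.le, hbN,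
        Real.rpow_natCast] at h3
      calc C * (1 / N) ^ n = C * N * (1 / N) ^ (n + 1) := by rw [pow_succ]; field_simp
        _ ≤ C * N * D ^ (σ : ℝ) := mul_le_mul_of_nonneg_left h3 (by positivity)
  have hCN : ENNReal.ofReal (C * N) ≠ 0 := by
    rw [Ne, ENNReal.ofReal_eq_zero, not_le]
    positivity
  have hle : (ENNReal.ofReal (C * N))⁻¹ • μ ≤ μH[(σ : ℝ)] := by
    refine Measure.le_hausdorffMeasure _ _ 1 one_pos fun s hs => ?_
    rw [Measure.smul_apply, smul_eq_mul, mul_comm, ← div_eq_mul_inv]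
    exact ENNReal.div_le_of_le_mul' (hkey s hs)
  have hne : μH[(σ : ℝ)] A ≠ 0 := by
    intro h0
    have h1 := hle A
    rw [h0, Measure.smul_apply, smul_eq_mul] at h1
    rcases mul_eq_zero.1 (le_antisymm h1 zero_le) with h2 | h2
    · exact ENNReal.ofReal_ne_top (ENNReal.inv_eq_zero.1 h2)
    · exact hμ h2
  have hdim : (σ : ℝ) ≤ (dimH A).toReal := by
    have := ENNReal.toReal_mono (Real.dimH_ne_top A) (le_dimH_of_hausdorffMeasure_ne_zero hne)
    simpa using this
  calc (N : ℝ) = (1 / b) ^ (σ : ℝ) := hNb.symm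
    _ ≤ _ := Real.rpow_le_rpow_of_exponent_le ((one_le_div hb).2 hb1.le) hdim

end MassDistribution

section BlockWords

variable {I : Type*} {N m : ℕ}

/-- Concatenation of blocks of length `m` selected by a finite sequence of block labels. -/
def blockWord (e : Fin N → Fin m → I) {n : ℕ} (u : Fin n → Fin N) : List I :=
  (List.ofFn fun j => List.ofFn (e (u j))).flatten

/-- The infinite concatenation of blocks of length `m`. -/
def blockSeq (hm : 0 < m) (e : Fin N → Fin m → I) (ω : ℕ → Fin N) (k : ℕ) : I :=
  e (ω (k / m)) ⟨k % m, Nat.mod_lt k hm⟩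

theorem blockWord_succ (e : Fin N → Fin m → I) {n : ℕ} (u : Fin (n + 1) → Fin N) :
    blockWord e u = List.ofFn (e (u 0)) ++ blockWord e (fun j => u j.succ) := by
  rw [blockWord, List.ofFn_succ, List.flatten_cons]
  rfl

theorem length_blockWord (e : Fin N → Fin m → I) {n : ℕ} (u : Fin n → Fin N) :
    (blockWord e u).length = n * m := by
  induction n with
  | zero => simp [blockWord]
  | succ n ih => rw [blockWord_succ, List.length_append, ih, List.length_ofFn]; ring

theorem blockWord_injective {e : Fin N → Fin m → I} (he : Function.Injective e) (n : ℕ) :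
    Function.Injective (fun u : Fin n → Fin N => blockWord e u) := by
  induction n with
  | zero => exact fun u v _ => Subsingleton.elim u v
  | succ n ih =>
    intro u v huv
    simp only [blockWord_succ] at huv
    obtain ⟨h1, h2⟩ := List.append_inj huv (by simp)
    have h3 := he (List.ofFn_injective h1)
    have h4 := ih h2
    funext j
    refine Fin.cases h3 (fun i => congrFun h4 i) j

theorem ofFn_blockSeq (hm : 0 < m) (e : Fin N → Fin m → I) (ω : ℕ → Fin N) (n : ℕ) :
    (List.ofFn fun k : Fin (n * m) => blockSeq hm e ω k) =
      blockWord e (fun j : Fin n => ω j) := by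
  rw [List.ofFn_mul, blockWord]
  congr 1
  refine congrArg List.ofFn (funext fun i => congrArg List.ofFn (funext fun j => ?_))
  have h1 : ((i : ℕ) * m + j) / m = i := by
    rw [mul_comm, Nat.mul_add_div hm, Nat.div_eq_of_lt j.2, add_zero]
  have h2 : ((i : ℕ) * m + j) % m = j := by
    rw [mul_comm, Nat.mul_add_mod, Nat.mod_eq_of_lt j.2]
  simp only [blockSeq, h1, h2]

end BlockWords

namespace CIFS

variable {d : ℕ} (Φ : CIFS d)

theorem continuousOn_compMaps (w : List Φ.I) : ContinuousOn (compMaps Φ.S w) Φ.X :=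
  LipschitzOnWith.continuousOn (K := (Φ.c ^ w.length).toNNReal)
    (LipschitzOnWith.of_dist_le_mul fun x hx y hy => by
      rw [Real.coe_toNNReal _ (pow_nonneg Φ.hc0.le _)]
      exact Φ.dist_compMaps_le w hx hy)

theorem nonempty_iInter_image (γ : ℕ → Φ.I) :
    (⋂ n : ℕ, compMaps Φ.S (List.ofFn fun k : Fin n => γ k) '' Φ.X).Nonempty := by
  have hcomp : ∀ n : ℕ, IsCompact (compMaps Φ.S (List.ofFn fun k : Fin n => γ k) '' Φ.X) :=
    fun n => Φ.hXcompact.image_of_continuousOn (Φ.continuousOn_compMaps _)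
  refine IsCompact.nonempty_iInter_of_sequence_nonempty_isCompact_isClosed _ (fun n => ?_)
    (fun n => ⟨_, mem_image_of_mem _ Φ.basePoint_mem⟩) (hcomp 0) (fun n => (hcomp n).isClosed)
  rw [List.ofFn_succ', List.concat_eq_append, compMaps_append, image_comp]
  exact image_mono (Φ.compMaps_S_mapsTo _).image_subset

/-- The point of the limit set with a given address. -/
def coding (γ : ℕ → Φ.I) : EuclideanSpace ℝ (Fin d) := (Φ.nonempty_iInter_image γ).some

theorem coding_mem_image (γ : ℕ → Φ.I) (n : ℕ) :
    Φ.coding γ ∈ compMaps Φ.S (List.ofFn fun k : Fin n => γ k) '' Φ.X :=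
  mem_iInter.1 (Φ.nonempty_iInter_image γ).some_mem n

theorem coding_mem_limitSet (γ : ℕ → Φ.I) : Φ.coding γ ∈ Φ.limitSet :=
  mem_iUnion.2 ⟨γ, mem_iInter.2 fun n => Φ.coding_mem_image γ (n + 1)⟩

variable {N m : ℕ}

theorem coding_blockSeq_mem_image (hm : 0 < m) (e : Fin N → Fin m → Φ.I) (ω : ℕ → Fin N)
    (n : ℕ) :
    Φ.coding (blockSeq hm e ω) ∈ compMaps Φ.S (blockWord e fun j : Fin n => ω j) '' Φ.X := by
  rw [← ofFn_blockSeq hm]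
  exact Φ.coding_mem_image _ _

theorem continuous_coding_blockSeq (hm : 0 < m) (e : Fin N → Fin m → Φ.I) :
    Continuous fun ω : ℕ → Fin N => Φ.coding (blockSeq hm e ω) := by
  rw [Metric.continuous_iff']
  intro ω ε hε
  have hlim : Tendsto (fun n : ℕ => Φ.c ^ n * diam Φ.X) atTop (𝓝 0) := by
    simpa using (tendsto_pow_atTop_nhds_zero_of_lt_one Φ.hc0.le Φ.hc1).mul_const (diam Φ.X)
  obtain ⟨n, hn⟩ := (hlim.eventually_lt_const hε).exists
  have hev : ∀ᶠ ω' in 𝓝 ω, ∀ j : Fin n, ω' j = ω j :=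
    eventually_all.2 fun j => (continuous_apply (j : ℕ)).continuousAt.eventually_mem
      ((isOpen_discrete {ω j}).mem_nhds rfl)
  filter_upwards [hev] with ω' hω'
  obtain ⟨x, hx, hxe⟩ := Φ.coding_blockSeq_mem_image hm e ω n
  obtain ⟨y, hy, hye⟩ := Φ.coding_blockSeq_mem_image hm e ω' n
  rw [show (fun j : Fin n => ω' j) = fun j : Fin n => ω j from funext hω'] at hye
  rw [← hxe, ← hye]
  refine (Φ.dist_compMaps_le _ hy hx).trans_lt (lt_of_le_of_lt ?_ hn)
  rw [length_blockWord]
  refine mul_le_mul ?_ (dist_le_diam_of_mem Φ.hXcompact.isBounded hy hx) dist_nonneg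
    (pow_nonneg Φ.hc0.le _)
  exact pow_le_pow_of_le_one Φ.hc0.le Φ.hc1.le (Nat.le_mul_of_pos_right n hm)

variable [NeZero d]

theorem pow_le_size_blockWord {e : Fin N → Fin m → Φ.I} {δ : ℝ} (hδ0 : 0 ≤ δ)
    (hδ : ∀ k, δ ≤ Φ.size (List.ofFn (e k))) {n : ℕ} (u : Fin n → Fin N) :
    (δ / Φ.K) ^ n ≤ Φ.size (blockWord e u) := by
  induction n with
  | zero => simp [blockWord, Φ.size_nil]
  | succ n ih =>
    rw [blockWord_succ, pow_succ']
    refine le_trans ?_ (Φ.le_size_append _ _)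
    have hK := Φ.K_pos
    exact mul_le_mul (div_le_div_of_nonneg_right (hδ _) hK.le) (ih _) (by positivity)
      (div_nonneg (Φ.size_pos _).le hK.le)

/-- A family of `N` words of common length whose maps contract by at least `δ` forces the
Hausdorff dimension of the limit set to be at least `log N / log (K / δ)`. -/
theorem natCast_le_rpow_dimH {e : Fin N → Fin m → Φ.I} (he : Function.Injective e) {δ : ℝ}
    (hδ0 : 0 < δ) (hδ : ∀ k, δ ≤ Φ.size (List.ofFn (e k))) (hN : 2 ≤ N) :
    (N : ℝ) ≤ (Φ.K / δ) ^ (dimH Φ.limitSet).toReal := by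
  have hm : 0 < m := by
    rcases Nat.eq_zero_or_pos m with rfl | hm
    · have := Fintype.card_le_of_injective e he
      simp only [Fintype.card_fin, Fintype.card_unique] at this
      omega
    · exact hm
  have hK := Φ.K_pos
  have hN0 : 0 < N := by omega
  have : Nonempty (Fin N) := ⟨⟨0, hN0⟩⟩
  have hδc : δ < 1 := by
    refine (hδ ⟨0, hN0⟩).trans_lt ((Φ.size_le_pow _).trans_lt ?_)
    exact pow_lt_one₀ Φ.hc0.le Φ.hc1 (by simp [hm.ne'])
  have hb : 0 < δ / Φ.K := div_pos hδ0 hK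
  have hb1 : δ / Φ.K < 1 := (div_lt_one hK).2 (hδc.trans_le Φ.hK)
  obtain ⟨C, hC⟩ := Φ.exists_card_le_of_pairwiseDisjoint (M := 2) zero_le_two
  let p : Measure (Fin N) := (PMF.uniformOfFintype (Fin N)).toMeasure
  have : IsProbabilityMeasure p := PMF.toMeasure.isProbabilityMeasure _
  let P : Measure (ℕ → Fin N) := Measure.infinitePi fun _ => p
  have hcyl : ∀ (n : ℕ) (u : Fin n → Fin N),
      P {ω | ∀ j : Fin n, ω j = u j} = ENNReal.ofReal ((1 / N) ^ n) := by
    intro n u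
    have hset : {ω : ℕ → Fin N | ∀ j : Fin n, ω j = u j} =
        Set.pi (Finset.range n : Set ℕ)
          (fun k => {i | ∀ h : k < n, i = u ⟨k, h⟩}) := by
      ext ω
      simp only [mem_ofPred_eq, Set.mem_pi, Finset.coe_range, mem_Iio]
      exact ⟨fun h k _ hk => h ⟨k, hk⟩, fun h j => h j j.2 j.2⟩
    rw [hset, Measure.infinitePi_pi _ (fun _ _ => MeasurableSet.of_discrete), Finset.prod_range]
    have hone : ∀ j : Fin n, p {i | ∀ h : (j : ℕ) < n, i = u ⟨j, h⟩} =
        ENNReal.ofReal (1 / N) := by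
      intro j
      have : {i | ∀ h : (j : ℕ) < n, i = u ⟨j, h⟩} = {u j} := by
        ext i
        simp
      rw [this, PMF.toMeasure_apply_singleton _ _ MeasurableSet.of_discrete,
        PMF.uniformOfFintype_apply, Fintype.card_fin, one_div,
        ENNReal.ofReal_inv_of_pos (by exact_mod_cast hN0), ENNReal.ofReal_natCast]
    rw [Finset.prod_congr rfl fun j _ => hone j, Finset.prod_const, Finset.card_univ,
      Fintype.card_fin, ENNReal.ofReal_pow (by positivity)]
  let f : (ℕ → Fin N) → EuclideanSpace ℝ (Fin d) := fun ω => Φ.coding (blockSeq hm e ω)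
  have hf : Measurable f := (Φ.continuous_coding_blockSeq hm e).measurable
  have hmass : P.map f Φ.limitSet ≠ 0 := by
    have h1 := Measure.le_map_apply (μ := P) hf.aemeasurable Φ.limitSet
    have h2 : f ⁻¹' Φ.limitSet = univ := eq_univ_of_forall fun ω => Φ.coding_mem_limitSet _
    rw [h2, measure_univ] at h1
    exact (zero_lt_one.trans_le h1).ne'
  have hresult := natCast_le_rpow_dimH_of_measure_le (P.map f) hmass (C := max C 1) (b := δ / Φ.K)
    (by positivity) hb hb1 hN ?_
  · rwa [one_div_div] at hresult
  intro n s hs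
  classical
  refine (measure_mono (subset_closure (s := s))).trans ?_
  rw [Measure.map_apply hf isClosed_closure.measurableSet]
  let J : Finset (Fin n → Fin N) := Finset.univ.filter fun u =>
    ∃ x ∈ Φ.X, compMaps Φ.S (blockWord e u) x ∈ closure s
  have hJ : ∀ u ∈ J, ∃ x ∈ Φ.X, compMaps Φ.S (blockWord e u) x ∈ closure s := fun u hu =>
    (Finset.mem_filter.1 hu).2
  choose! x hxX hxs using hJ
  have hcard : (J.card : ℝ) ≤ C := by
    rcases J.eq_empty_or_nonempty with h0 | ⟨v, hv⟩
    · have := hC (∅ : Finset (Fin n → Fin N)) (fun _ => []) (fun _ => 0) 0 1 one_pos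
        (by simp) (by simp) (by simp) (by simp)
      rw [h0]
      exact this
    · refine hC J (fun u => blockWord e u) x (compMaps Φ.S (blockWord e v) (x v))
        ((δ / Φ.K) ^ n / 2) (by positivity) hxX (fun u _ => ?_) ?_ (fun u hu => ?_)
      · exact (half_lt_self (by positivity)).trans_le (Φ.pow_le_size_blockWord hδ0.le hδ u)
      · intro u _ u' _ huu'
        refine (Φ.compMaps_T_disjoint (u := blockWord e u) (v := blockWord e u')
          (by rw [length_blockWord, length_blockWord])
          fun h => huu' (blockWord_injective he n h)).mono ?_ ?_ <;>
        exact image_mono inter_subset_right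
      · rw [mul_div_cancel₀ _ two_ne_zero]
        have h1 := (edist_le_ediam_of_mem (hxs u hu) (hxs v hv)).trans
          ((ediam_closure s).le.trans hs)
        rw [edist_dist] at h1
        exact (ENNReal.ofReal_le_ofReal_iff (by positivity)).1 h1
  have hcover : f ⁻¹' closure s ⊆ ⋃ u ∈ J, {ω | ∀ j : Fin n, ω j = u j} := by
    intro ω hω
    obtain ⟨y, hy, hye⟩ := Φ.coding_blockSeq_mem_image hm e ω n
    refine mem_iUnion₂.2 ⟨fun j => ω j, ?_, fun j => rfl⟩
    exact Finset.mem_filter.2 ⟨Finset.mem_univ _, y, hy, by rw [hye]; exact hω⟩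
  calc P (f ⁻¹' closure s) ≤ ∑ u ∈ J, P {ω | ∀ j : Fin n, ω j = u j} :=
        (measure_mono hcover).trans (measure_biUnion_finset_le _ _)
    _ = J.card * ENNReal.ofReal ((1 / N) ^ n) := by
        rw [Finset.sum_congr rfl fun u _ => hcyl n u, Finset.sum_const, nsmul_eq_mul]
    _ = ENNReal.ofReal (J.card * (1 / N) ^ n) := by
        rw [ENNReal.ofReal_mul (by positivity), ENNReal.ofReal_natCast]
    _ ≤ _ := ENNReal.ofReal_le_ofReal
        (mul_le_mul_of_nonneg_right (hcard.trans (le_max_left _ _)) (by positivity))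

end CIFS

namespace CIFS

variable {d : ℕ} (Φ : CIFS d)

theorem totallyBounded_X : TotallyBounded Φ.X := Φ.hXcompact.totallyBounded

theorem limitSet_subset : Φ.limitSet ⊆ Φ.X := by
  refine iUnion_subset fun γ => (iInter_subset _ 0).trans ?_
  exact (Φ.compMaps_S_mapsTo _).image_subset

theorem fixedPoints_subset : Φ.fixedPoints ⊆ Φ.X := fun _ hx => hx.1

theorem exists_fixedPoint (i : Φ.I) : ∃ p ∈ Φ.X, Φ.S i p = p := by
  have hcon : ContractingWith Φ.c.toNNReal ((Φ.hSmaps i).restrict (Φ.S i) Φ.X Φ.X) := by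
    refine ⟨by rw [← NNReal.coe_lt_coe, Real.coe_toNNReal _ Φ.hc0.le]; exact Φ.hc1, ?_⟩
    refine LipschitzWith.of_dist_le_mul fun x y => ?_
    rw [Real.coe_toNNReal _ Φ.hc0.le]
    exact (Φ.hcontr i x x.2 y y.2).2
  obtain ⟨p, hp, hfix, -⟩ := hcon.exists_fixedPoint' Φ.hXcompact.isComplete (Φ.hSmaps i)
    Φ.basePoint_mem (edist_ne_top _ _)
  exact ⟨p, hp, hfix⟩

theorem fixedPoints_nonempty : Φ.fixedPoints.Nonempty := by
  obtain ⟨i⟩ := Φ.hInonempty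
  obtain ⟨p, hp, hpi⟩ := Φ.exists_fixedPoint i
  exact ⟨p, hp, i, hpi⟩

theorem fixedPoints_subset_limitSet : Φ.fixedPoints ⊆ Φ.limitSet := by
  rintro p ⟨hp, i, hi⟩
  refine mem_iUnion.2 ⟨fun _ => i, mem_iInter.2 fun n => ⟨p, hp, ?_⟩⟩
  rw [List.ofFn_const]
  induction n + 1 with
  | zero => rfl
  | succ n ih => rw [List.replicate_succ, compMaps, Function.comp_apply, ih, hi]

theorem compMaps_S_mapsTo_limitSet (w : List Φ.I) :
    MapsTo (compMaps Φ.S w) Φ.limitSet Φ.limitSet := by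
  refine compMaps_mapsTo (fun i x hx => ?_) w
  obtain ⟨γ, hγ⟩ := mem_iUnion.1 hx
  rw [mem_iInter] at hγ
  refine mem_iUnion.2 ⟨fun k => Nat.casesOn k i γ, mem_iInter.2 fun n => ?_⟩
  rw [List.ofFn_succ, compMaps, image_comp]
  refine mem_image_of_mem _ ?_
  cases n with
  | zero => exact ⟨x, Φ.limitSet_subset hx, rfl⟩
  | succ n => exact hγ n

theorem length_le_of_lt_size {r : ℝ} (hr : 0 < r) {w : List Φ.I} (hw : r < Φ.size w) :
    w.length ≤ ⌊Real.log (1 / r) / Real.log (1 / Φ.c)⌋₊ := by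
  have hc : 0 < Real.log (1 / Φ.c) := Real.log_pos ((one_lt_div Φ.hc0).2 Φ.hc1)
  refine Nat.le_floor ((le_div_iff₀ hc).2 ?_)
  have h1 := Real.log_le_log hr (hw.le.trans (Φ.size_le_pow w))
  rw [Real.log_pow] at h1
  rw [one_div, one_div, Real.log_inv, Real.log_inv]
  linarith

variable [NeZero d]

theorem card_le_rpow_dimH {n : ℕ} {δ : ℝ} (hδ0 : 0 < δ) (hδ1 : δ ≤ 1) (J : Finset (List Φ.I))
    (hJ : ∀ w ∈ J, w.length = n ∧ δ ≤ Φ.size w) :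
    (J.card : ℝ) ≤ (Φ.K / δ) ^ (dimH Φ.limitSet).toReal := by
  rcases lt_or_ge J.card 2 with hlt | hge
  · have h1 : (J.card : ℝ) ≤ 1 := by exact_mod_cast Nat.lt_succ_iff.1 hlt
    exact h1.trans (Real.one_le_rpow ((one_le_div hδ0).2 (hδ1.trans Φ.hK)) ENNReal.toReal_nonneg)
  · have hex : ∀ k : Fin J.card, ∃ f : Fin n → Φ.I,
        List.ofFn f = (J.equivFin.symm k : List Φ.I) := by
      intro k
      obtain ⟨h, -⟩ := hJ _ (J.equivFin.symm k).2
      subst h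
      exact ⟨_, List.ofFn_get _⟩
    choose e he using hex
    refine Φ.natCast_le_rpow_dimH (e := e) (fun k l hkl => ?_) hδ0 (fun k => ?_) hge
    · apply J.equivFin.symm.injective
      apply Subtype.ext
      rw [← he, ← he, hkl]
    · rw [he]
      exact (hJ _ (J.equivFin.symm k).2).2

theorem finite_setOf_lt_size {r : ℝ} (hr : 0 < r) (hr1 : r ≤ 1) :
    {w : List Φ.I | r < Φ.size w}.Finite := by
  have hfin : ∀ n : ℕ, {w : List Φ.I | w.length = n ∧ r ≤ Φ.size w}.Finite := by
    intro n
    by_contra hinf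
    obtain ⟨N, hN⟩ := exists_nat_gt ((Φ.K / r) ^ (dimH Φ.limitSet).toReal)
    obtain ⟨J, hJ, hcard⟩ := Set.Infinite.exists_subset_card_eq hinf N
    have := Φ.card_le_rpow_dimH hr hr1 J fun w hw => hJ hw
    rw [hcard] at this
    exact absurd this hN.not_ge
  refine ((Set.finite_Iic ⌊Real.log (1 / r) / Real.log (1 / Φ.c)⌋₊).biUnion
    fun n _ => hfin n).subset fun w hw => ?_
  exact mem_biUnion (mem_Iic.2 (Φ.length_le_of_lt_size hr hw)) ⟨rfl, le_of_lt hw⟩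

theorem exists_sum_size_rpow_le :
    ∃ C : ℝ, 0 < C ∧ ∀ r : ℝ, 0 < r → r ≤ 1 → ∀ W : Finset (List Φ.I),
      (∀ w ∈ W, r < Φ.size w) →
      ∑ w ∈ W, Φ.size w ^ (dimH Φ.limitSet).toReal ≤ C * (Real.log (1 / r) + 1) ^ 2 := by
  set h := (dimH Φ.limitSet).toReal
  have hh : 0 ≤ h := ENNReal.toReal_nonneg
  have hK := Φ.K_pos
  have hc : 0 < Real.log (1 / Φ.c) := Real.log_pos ((one_lt_div Φ.hc0).2 Φ.hc1)
  refine ⟨(1 / Real.log (1 / Φ.c) + 1) * (Φ.K * Real.exp 1) ^ h, by positivity, ?_⟩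
  intro r hr hr1 W hW
  set L := Real.log (1 / r)
  have hL : 0 ≤ L := Real.log_nonneg ((one_le_div hr).2 hr1)
  set A := ⌊L / Real.log (1 / Φ.c)⌋₊
  set B := ⌊L⌋₊
  have hmaps : ∀ w ∈ W, (w.length, ⌊-Real.log (Φ.size w)⌋₊) ∈
      Finset.range (A + 1) ×ˢ Finset.range (B + 1) := by
    intro w hw
    rw [Finset.mem_product, Finset.mem_range, Finset.mem_range, Nat.lt_succ_iff, Nat.lt_succ_iff]
    refine ⟨Φ.length_le_of_lt_size hr (hW w hw), Nat.floor_le_floor ?_⟩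
    have := Real.log_le_log hr (hW w hw).le
    simp only [L, one_div, Real.log_inv]
    linarith
  have hfib : ∀ y ∈ Finset.range (A + 1) ×ˢ Finset.range (B + 1),
      ∑ w ∈ W with (w.length, ⌊-Real.log (Φ.size w)⌋₊) = y, Φ.size w ^ h ≤
        (Φ.K * Real.exp 1) ^ h := by
    rintro ⟨n, k⟩ -
    set J := W.filter fun w => (w.length, ⌊-Real.log (Φ.size w)⌋₊) = (n, k)
    have hJ : ∀ w ∈ J, w.length = n ∧ Real.exp (-(k + 1)) ≤ Φ.size w ∧
        Φ.size w ≤ Real.exp (-k) := by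
      intro w hw
      have hw2 := (Finset.mem_filter.1 hw).2
      rw [Prod.mk.injEq] at hw2
      obtain ⟨h1, h2⟩ := hw2
      have hlog : 0 ≤ -Real.log (Φ.size w) :=
        neg_nonneg.2 (Real.log_nonpos (Φ.size_pos w).le (Φ.size_le_one w))
      have h3 := (Nat.floor_eq_iff hlog).1 h2
      refine ⟨h1, ?_, ?_⟩
      · rw [← Real.le_log_iff_exp_le (Φ.size_pos w)]
        linarith
      · rw [← Real.log_le_iff_le_exp (Φ.size_pos w)]
        linarith
    have hcard := Φ.card_le_rpow_dimH (Real.exp_pos (-((k : ℝ) + 1)))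
      (Real.exp_le_one_iff.2 (by linarith [k.cast_nonneg (α := ℝ)])) J
      fun w hw => ⟨(hJ w hw).1, (hJ w hw).2.1⟩
    calc ∑ w ∈ J, Φ.size w ^ h ≤ ∑ w ∈ J, Real.exp (-k) ^ h :=
          Finset.sum_le_sum fun w hw => Real.rpow_le_rpow (Φ.size_pos w).le (hJ w hw).2.2 hh
      _ = J.card * Real.exp (-k) ^ h := by rw [Finset.sum_const, nsmul_eq_mul]
      _ ≤ (Φ.K / Real.exp (-(k + 1))) ^ h * Real.exp (-k) ^ h :=
          mul_le_mul_of_nonneg_right hcard (by positivity)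
      _ = (Φ.K * Real.exp 1) ^ h := by
          rw [← Real.mul_rpow (by positivity) (by positivity)]
          congr 1
          rw [div_mul_eq_mul_div, mul_div_assoc, ← Real.exp_sub]
          congr 2
          ring
  rw [← Finset.sum_fiberwise_of_maps_to hmaps]
  refine (Finset.sum_le_sum hfib).trans ?_
  rw [Finset.sum_const, nsmul_eq_mul, Finset.card_product, Finset.card_range, Finset.card_range]
  push_cast
  have hA : (A : ℝ) ≤ L / Real.log (1 / Φ.c) := Nat.floor_le (by positivity)
  have hB : (B : ℝ) ≤ L := Nat.floor_le hL
  have hA2 : (A : ℝ) + 1 ≤ (1 / Real.log (1 / Φ.c) + 1) * (L + 1) := by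
    have : 0 ≤ 1 / Real.log (1 / Φ.c) := by positivity
    rw [div_eq_mul_one_div] at hA
    nlinarith
  calc ((A : ℝ) + 1) * (B + 1) * (Φ.K * Real.exp 1) ^ h
      ≤ ((1 / Real.log (1 / Φ.c) + 1) * (L + 1)) * (L + 1) * (Φ.K * Real.exp 1) ^ h := by
        gcongr
    _ = _ := by ring

/-- The limit set is covered by images of covers of the set of fixed points under the maps
`S_w` that contract by more than `r`. -/
theorem exists_coveringNumber_limitSet_le_sum :
    ∃ C : ℝ, 0 < C ∧ ∀ r : ℝ, 0 < r → r < 1 → ∀ W : Finset (List Φ.I),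
      (∀ w, r < Φ.size w → w ∈ W) →
      (_root_.coveringNumber Φ.limitSet r : ℝ) ≤
        C * ∑ w ∈ W, (_root_.coveringNumber Φ.fixedPoints (r / Φ.size w) : ℝ) := by
  classical
  obtain ⟨L, hL, hLip⟩ := Φ.exists_dist_compMaps_le
  set D := diam Φ.X
  have hD : 0 ≤ D := diam_nonneg
  have hK := Φ.K_pos
  have hL0 : 0 < L := by linarith
  obtain ⟨m, hm⟩ := exists_coveringNumber_le_mul (V := EuclideanSpace ℝ (Fin d))
    (L * (L * Φ.K * D + 2) + 1)
  refine ⟨m + 1, by positivity, ?_⟩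
  intro r hr hr1 W hW
  have hcov : ∀ w : List Φ.I, ∃ t : Finset (EuclideanSpace ℝ (Fin d)),
      t.card ≤ _root_.coveringNumber Φ.fixedPoints (r / Φ.size w) ∧ (∀ q ∈ t, q ∈ Φ.X) ∧
      ∀ p ∈ Φ.fixedPoints, ∃ q ∈ t, dist p q ≤ 2 * (r / Φ.size w) := by
    intro w
    obtain ⟨t, htc, ht⟩ := exists_cover_card_eq_coveringNumber
      (Φ.totallyBounded_X.subset Φ.fixedPoints_subset) (div_pos hr (Φ.size_pos w))
    have hf : ∀ q, ∃ q' ∈ Φ.X, ∀ p ∈ Φ.fixedPoints, p ∈ ball q (r / Φ.size w) →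
        q' ∈ ball q (r / Φ.size w) := by
      intro q
      by_cases hq : ∃ p ∈ Φ.fixedPoints, p ∈ ball q (r / Φ.size w)
      · obtain ⟨p, hp, hpq⟩ := hq
        exact ⟨p, hp.1, fun _ _ _ => hpq⟩
      · exact ⟨_, Φ.basePoint_mem, fun p hp hpq => absurd ⟨p, hp, hpq⟩ hq⟩
    choose f hfX hf using hf
    refine ⟨t.image f, Finset.card_image_le.trans htc.le, ?_, fun p hp => ?_⟩
    · intro q hq
      obtain ⟨q, -, rfl⟩ := Finset.mem_image.1 hq
      exact hfX q
    · obtain ⟨q, hq, hpq⟩ := mem_iUnion₂.1 (ht hp)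
      refine ⟨f q, Finset.mem_image_of_mem _ hq, ?_⟩
      have h1 := mem_ball.1 (hf q p hp hpq)
      have h2 := mem_ball.1 hpq
      linarith [dist_triangle_right p (f q) q]
  choose t htc htX ht using hcov
  have hmain : _root_.coveringNumber Φ.limitSet ((L * (L * Φ.K * D + 2) + 1) * r) ≤
      ∑ w ∈ W, _root_.coveringNumber Φ.fixedPoints (r / Φ.size w) := by
    refine (coveringNumber_le_card (W.biUnion fun w => (t w).image (compMaps Φ.S w)) ?_).trans
      (Finset.card_biUnion_le.trans
        (Finset.sum_le_sum fun w _ => Finset.card_image_le.trans (htc w)))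
    intro x hx
    obtain ⟨γ, hγ⟩ := mem_iUnion.1 hx
    rw [mem_iInter] at hγ
    have hex : ∃ n : ℕ, Φ.size (List.ofFn fun k : Fin n => γ k) ≤ r := by
      obtain ⟨n, hn⟩ := exists_pow_lt_of_lt_one hr Φ.hc1
      refine ⟨n, (Φ.size_le_pow _).trans ?_⟩
      rw [List.length_ofFn]
      exact hn.le
    obtain ⟨n, hn, hmin⟩ : ∃ n : ℕ, Φ.size (List.ofFn fun k : Fin (n + 1) => γ k) ≤ r ∧
        r < Φ.size (List.ofFn fun k : Fin n => γ k) := by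
      have h0 : Nat.find hex ≠ 0 := by
        intro h0
        have := Nat.find_spec hex
        rw [h0, List.ofFn_zero, Φ.size_nil] at this
        linarith
      obtain ⟨n, hn⟩ := Nat.exists_eq_succ_of_ne_zero h0
      have h1 := Nat.find_spec hex
      rw [hn] at h1
      exact ⟨n, h1, not_le.1 (Nat.find_min hex (by omega))⟩
    set w := List.ofFn fun k : Fin n => γ k with hw
    have hsplit : (List.ofFn fun k : Fin (n + 1) => γ k) = w ++ [γ n] := by
      rw [List.ofFn_succ', List.concat_eq_append]
      rfl
    obtain ⟨y, hy, hyx⟩ := hγ n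
    rw [hsplit] at hn hyx
    rw [compMaps_append, Function.comp_apply] at hyx
    obtain ⟨p, hpX, hp⟩ := Φ.exists_fixedPoint (γ n)
    obtain ⟨q, hq, hpq⟩ := ht w p ⟨hpX, _, hp⟩
    refine mem_iUnion₂.2 ⟨compMaps Φ.S w q, Finset.mem_biUnion.2
      ⟨w, hW w hmin, Finset.mem_image_of_mem _ hq⟩, ?_⟩
    have hs := Φ.size_pos w
    have h1 := hLip [γ n] y hy p hpX
    rw [show compMaps Φ.S [γ n] p = p from hp] at h1
    have h2 := hLip w _ (Φ.compMaps_S_mapsTo [γ n] hy) q (htX w q hq)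
    rw [hyx] at h2
    have h3 := dist_le_diam_of_mem Φ.hXcompact.isBounded hy hpX
    have h4 := Φ.le_size_append w [γ n]
    have h5 : Φ.size w * Φ.size [γ n] ≤ Φ.K * r := by
      have : Φ.size w * Φ.size [γ n] = Φ.K * (Φ.size w / Φ.K * Φ.size [γ n]) := by
        field_simp
      rw [this]
      exact mul_le_mul_of_nonneg_left (h4.trans hn) hK.le
    have h6 := dist_triangle (compMaps Φ.S [γ n] y) p q
    have h7 : Φ.size w * (2 * (r / Φ.size w)) = 2 * r := by field_simp
    have hsi := (Φ.size_pos [γ n]).le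
    rw [mem_ball]
    calc dist x (compMaps Φ.S w q)
        ≤ L * Φ.size w * (L * Φ.size [γ n] * D + 2 * (r / Φ.size w)) := by
          refine h2.trans (mul_le_mul_of_nonneg_left (h6.trans (add_le_add (h1.trans ?_) hpq))
            (by positivity))
          exact mul_le_mul_of_nonneg_left h3 (by positivity)
      _ = L * (L * D * (Φ.size w * Φ.size [γ n]) + Φ.size w * (2 * (r / Φ.size w))) := by ring
      _ ≤ L * (L * D * (Φ.K * r) + 2 * r) := by
          rw [h7]
          gcongr
      _ < (L * (L * Φ.K * D + 2) + 1) * r := by linarith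
  have h1 := hm Φ.limitSet (Φ.totallyBounded_X.subset Φ.limitSet_subset) r hr (by positivity)
  have h2 := h1.trans (Nat.mul_le_mul_left m hmain)
  calc (_root_.coveringNumber Φ.limitSet r : ℝ)
      ≤ m * ∑ w ∈ W, (_root_.coveringNumber Φ.fixedPoints (r / Φ.size w) : ℝ) := by
        exact_mod_cast h2
    _ ≤ _ := mul_le_mul_of_nonneg_right (by linarith) (by positivity)

theorem exists_coveringNumber_limitSet_le :
    ∃ C : ℝ, 0 < C ∧ ∀ r : ℝ, 0 < r → r < 1 → ∀ M : ℝ, 0 ≤ M →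
      (∀ ρ : ℝ, r ≤ ρ → ρ < 1 → (_root_.coveringNumber Φ.fixedPoints ρ : ℝ) ≤
        M * (r / ρ) ^ (dimH Φ.limitSet).toReal) →
      (_root_.coveringNumber Φ.limitSet r : ℝ) ≤ C * M * (Real.log (1 / r) + 1) ^ 2 := by
  obtain ⟨C₁, hC₁, h₁⟩ := Φ.exists_sum_size_rpow_le
  obtain ⟨C₂, hC₂, h₂⟩ := Φ.exists_coveringNumber_limitSet_le_sum
  refine ⟨C₂ * C₁, by positivity, fun r hr hr1 M hM h => ?_⟩
  have hfin := Φ.finite_setOf_lt_size hr hr1.le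
  have hW : ∀ w, w ∈ hfin.toFinset ↔ r < Φ.size w := fun w => hfin.mem_toFinset
  refine (h₂ r hr hr1 hfin.toFinset fun w => (hW w).2).trans ?_
  have hsum : ∑ w ∈ hfin.toFinset, (_root_.coveringNumber Φ.fixedPoints (r / Φ.size w) : ℝ) ≤
      ∑ w ∈ hfin.toFinset, M * Φ.size w ^ (dimH Φ.limitSet).toReal := by
    refine Finset.sum_le_sum fun w hw => ?_
    have hs := Φ.size_pos w
    have h3 := h (r / Φ.size w)
      ((le_div_iff₀ hs).2 (mul_le_of_le_one_right hr.le (Φ.size_le_one w)))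
      ((div_lt_one hs).2 ((hW w).1 hw))
    rwa [div_div_cancel₀ hr.ne'] at h3
  rw [← Finset.mul_sum] at hsum
  have h4 := h₁ r hr hr1.le hfin.toFinset fun w => (hW w).1
  calc _ ≤ C₂ * (M * (C₁ * (Real.log (1 / r) + 1) ^ 2)) := by gcongr; exact hsum.trans (by gcongr)
    _ = _ := by ring

end CIFS

theorem Set.InjOn.disjoint_image {α β : Type*} {f : α → β} {s t u : Set α} (hf : InjOn f u)
    (hs : s ⊆ u) (ht : t ⊆ u) (h : Disjoint s t) : Disjoint (f '' s) (f '' t) := by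
  rw [disjoint_iff_inter_eq_empty, ← hf.image_inter hs ht, h.inter_eq, image_empty]

namespace CIFS

variable {d : ℕ} (Φ : CIFS d) [NeZero d]

theorem exists_one_le_sum_rpow {t : ℝ} (ht : 0 ≤ t) (hth : t < (dimH Φ.limitSet).toReal) :
    ∃ n : ℕ, ∃ B : Finset (List Φ.I), (∀ u ∈ B, u.length = n + 1) ∧
      1 ≤ ∑ u ∈ B, (Φ.size u / Φ.K) ^ t := by
  classical
  by_contra! hcon
  have hcount := Φ.hIcount
  have hK := Φ.K_pos
  obtain ⟨L, hL, hLip⟩ := Φ.exists_dist_compMaps_le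
  set D := diam Φ.X
  have hD : 0 ≤ D := diam_nonneg
  have hnt : dimH Φ.limitSet ≠ ⊤ := by
    intro h
    rw [h, ENNReal.toReal_top] at hth
    linarith
  have htop : μH[t] Φ.limitSet = ⊤ := by
    have := hausdorffMeasure_of_lt_dimH (s := Φ.limitSet) (d := t.toNNReal)
      ((ENNReal.ofReal_lt_iff_lt_toReal ht hnt).2 hth)
    rwa [Real.coe_toNNReal _ ht] at this
  have hdiam : ∀ w : List Φ.I, ediam (compMaps Φ.S w '' Φ.X) ≤
      ENNReal.ofReal (L * Φ.size w * D) := by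
    intro w
    refine ediam_le ?_
    rintro _ ⟨x, hx, rfl⟩ _ ⟨y, hy, rfl⟩
    rw [edist_dist]
    refine ENNReal.ofReal_le_ofReal ((hLip w x hx y hy).trans ?_)
    exact mul_le_mul_of_nonneg_left (dist_le_diam_of_mem Φ.hXcompact.isBounded hx hy)
      (mul_nonneg (by linarith) (Φ.size_pos w).le)
  have hsum : ∀ n : ℕ, ∑' f : Fin (n + 1) → Φ.I,
      ediam (compMaps Φ.S (List.ofFn f) '' Φ.X) ^ t ≤ ENNReal.ofReal ((L * Φ.K * D) ^ t) := by
    intro n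
    rw [ENNReal.tsum_eq_iSup_sum]
    refine iSup_le fun s => ?_
    have h1 := hcon n (s.map ⟨List.ofFn, List.ofFn_injective⟩) (by simp)
    rw [Finset.sum_map] at h1
    simp only [Function.Embedding.coeFn_mk] at h1
    have h0 : ∀ f : Fin (n + 1) → Φ.I, 0 ≤ Φ.size (List.ofFn f) := fun f => (Φ.size_pos _).le
    calc ∑ f ∈ s, ediam (compMaps Φ.S (List.ofFn f) '' Φ.X) ^ t
        ≤ ∑ f ∈ s, ENNReal.ofReal
            ((L * Φ.K * D) ^ t * (Φ.size (List.ofFn f) / Φ.K) ^ t) := by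
          refine Finset.sum_le_sum fun f _ => ?_
          have hf := h0 f
          rw [← Real.mul_rpow (by positivity) (by positivity),
            show L * Φ.K * D * (Φ.size (List.ofFn f) / Φ.K) = L * Φ.size (List.ofFn f) * D by
              field_simp,
            ← ENNReal.ofReal_rpow_of_nonneg (by positivity) ht]
          exact ENNReal.rpow_le_rpow (hdiam _) ht
      _ = ENNReal.ofReal ((L * Φ.K * D) ^ t * ∑ f ∈ s, (Φ.size (List.ofFn f) / Φ.K) ^ t) := by
          rw [Finset.mul_sum, ENNReal.ofReal_sum_of_nonneg]
          intro f _
          have hf := h0 f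
          positivity
      _ ≤ _ := ENNReal.ofReal_le_ofReal (mul_le_of_le_one_right (by positivity) h1.le)
  have hlim : Tendsto (fun n : ℕ => ENNReal.ofReal (Φ.c ^ (n + 1) * (L * D))) atTop (𝓝 0) := by
    rw [← ENNReal.ofReal_zero]
    refine ENNReal.tendsto_ofReal ?_
    have := ((tendsto_pow_atTop_nhds_zero_of_lt_one Φ.hc0.le Φ.hc1).comp
      (tendsto_add_atTop_nat 1)).mul_const (L * D)
    rwa [zero_mul] at this
  have hle := Measure.hausdorffMeasure_le_liminf_tsum t Φ.limitSet
    (fun n : ℕ => ENNReal.ofReal (Φ.c ^ (n + 1) * (L * D))) hlim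
    (fun (n : ℕ) (f : Fin (n + 1) → Φ.I) => compMaps Φ.S (List.ofFn f) '' Φ.X)
    (Eventually.of_forall fun n f => (hdiam _).trans (ENNReal.ofReal_le_ofReal ?_))
    (Eventually.of_forall fun n x hx => ?_)
  · rw [htop, top_le_iff] at hle
    have h2 : liminf (fun n : ℕ => ∑' f : Fin (n + 1) → Φ.I,
        ediam (compMaps Φ.S (List.ofFn f) '' Φ.X) ^ t) atTop ≤
          ENNReal.ofReal ((L * Φ.K * D) ^ t) := by
      refine (liminf_le_liminf (Eventually.of_forall hsum)).trans ?_
      rw [liminf_const]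
    rw [hle] at h2
    exact absurd h2 (by simp)
  · have h3 := Φ.size_le_pow (List.ofFn f)
    rw [List.length_ofFn] at h3
    calc L * Φ.size (List.ofFn f) * D = Φ.size (List.ofFn f) * (L * D) := by ring
      _ ≤ _ := mul_le_mul_of_nonneg_right h3 (by positivity)
  · obtain ⟨γ, hγ⟩ := mem_iUnion.1 hx
    exact mem_iUnion.2 ⟨fun k => γ k, mem_iInter.1 hγ n⟩

/-- There are many disjoint cylinders of size at least a given scale. -/
theorem exists_pairwiseDisjoint_cylinders {t : ℝ} (ht : 0 ≤ t)
    (hth : t = 0 ∨ t < (dimH Φ.limitSet).toReal) :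
    ∃ b : ℝ, 0 < b ∧ ∀ δ : ℝ, 0 < δ → δ ≤ 1 → ∃ W : Finset (List Φ.I),
      (W : Set (List Φ.I)).PairwiseDisjoint (fun w => compMaps Φ.T w '' interior Φ.X) ∧
      (∀ w ∈ W, b * δ ≤ Φ.size w) ∧ δ ^ (-t) ≤ W.card := by
  classical
  rcases hth with rfl | hth
  · exact ⟨1, one_pos, fun δ _ hδ => ⟨{[]}, by simp, by simpa [Φ.size_nil] using hδ, by simp⟩⟩
  obtain ⟨n, B, hlen, hB⟩ := Φ.exists_one_le_sum_rpow ht hth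
  have hK := Φ.K_pos
  have hne : B.Nonempty := by
    by_contra h
    rw [Finset.not_nonempty_iff_eq_empty] at h
    rw [h, Finset.sum_empty] at hB
    linarith
  obtain ⟨u₀, -, hu₀⟩ := B.exists_min_image (fun u => Φ.size u / Φ.K) hne
  set b := Φ.size u₀ / Φ.K with hb
  have hb0 : 0 < b := div_pos (Φ.size_pos _) hK
  have hb1 : b ≤ 1 := (div_le_one hK).2 ((Φ.size_le_one _).trans Φ.hK)
  have hac : ∀ u ∈ B, Φ.size u / Φ.K ≤ Φ.c := by
    intro u hu
    refine (div_le_self (Φ.size_pos u).le Φ.hK).trans ((Φ.size_le_pow u).trans ?_)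
    rw [hlen u hu]
    exact pow_le_of_le_one Φ.hc0.le Φ.hc1.le n.succ_ne_zero
  have hlarge : ∀ δ : ℝ, 1 ≤ δ → δ ≤ 1 / b → ∃ W : Finset (List Φ.I),
      (W : Set (List Φ.I)).PairwiseDisjoint (fun w => compMaps Φ.T w '' interior Φ.X) ∧
      (∀ w ∈ W, b * δ ≤ Φ.size w) ∧ δ ^ (-t) ≤ W.card := by
    intro δ hδ1 hδb
    refine ⟨{[]}, by simp, ?_, ?_⟩
    · intro w hw
      rw [Finset.mem_singleton.1 hw, Φ.size_nil, mul_comm]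
      exact (le_div_iff₀ hb0).1 hδb
    · simpa using Real.rpow_le_one_of_one_le_of_nonpos hδ1 (neg_nonpos.2 ht)
  have hind : ∀ k : ℕ, ∀ δ : ℝ, Φ.c ^ k ≤ δ → δ ≤ 1 / b → ∃ W : Finset (List Φ.I),
      (W : Set (List Φ.I)).PairwiseDisjoint (fun w => compMaps Φ.T w '' interior Φ.X) ∧
      (∀ w ∈ W, b * δ ≤ Φ.size w) ∧ δ ^ (-t) ≤ W.card := by
    intro k
    induction k with
    | zero => exact fun δ h => hlarge δ (by simpa using h)
    | succ k ih =>
      intro δ hδ hδb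
      rcases le_or_gt 1 δ with h1 | h1
      · exact hlarge δ h1 hδb
      have hδ0 : 0 < δ := (pow_pos Φ.hc0 _).trans_le hδ
      have hex : ∀ u ∈ B, ∃ W : Finset (List Φ.I),
          (W : Set (List Φ.I)).PairwiseDisjoint (fun w => compMaps Φ.T w '' interior Φ.X) ∧
          (∀ w ∈ W, b * (δ / (Φ.size u / Φ.K)) ≤ Φ.size w) ∧
          (δ / (Φ.size u / Φ.K)) ^ (-t) ≤ W.card := by
        intro u hu
        have ha : 0 < Φ.size u / Φ.K := div_pos (Φ.size_pos u) hK
        refine ih _ ((le_div_iff₀ ha).2 ?_) (div_le_div₀ zero_le_one h1.le hb0 (hu₀ u hu))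
        refine le_trans ?_ hδ
        rw [pow_succ]
        exact mul_le_mul_of_nonneg_left (hac u hu) (pow_nonneg Φ.hc0.le _)
      choose! W hWd hWs hWc using hex
      refine ⟨B.biUnion fun u => (W u).image (u ++ ·), ?_, ?_, ?_⟩
      · intro w hw w' hw' hww'
        obtain ⟨u, hu, hw⟩ := Finset.mem_biUnion.1 (Finset.mem_coe.1 hw)
        obtain ⟨v, hv, rfl⟩ := Finset.mem_image.1 hw
        obtain ⟨u', hu', hw'⟩ := Finset.mem_biUnion.1 (Finset.mem_coe.1 hw')
        obtain ⟨v', hv', rfl⟩ := Finset.mem_image.1 hw'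
        simp only [Function.onFun, compMaps_append, image_comp]
        by_cases huu : u = u'
        · subst huu
          have hvv : v ≠ v' := fun h => hww' (by rw [h])
          have hsub : ∀ v : List Φ.I, compMaps Φ.T v '' interior Φ.X ⊆ Φ.V := fun v =>
            (Φ.compMaps_T_mapsTo_interior v).image_subset.trans Φ.interior_subset_V
          exact (Φ.compMaps_T_injOn u).disjoint_image (hsub v) (hsub v')
            (hWd u hu hv hv' hvv)
        · refine (Φ.compMaps_T_disjoint ((hlen u hu).trans (hlen u' hu').symm) huu).mono ?_ ?_ <;>
          exact image_mono (Φ.compMaps_T_mapsTo_interior _).image_subset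
      · intro w hw
        obtain ⟨u, hu, hw⟩ := Finset.mem_biUnion.1 hw
        obtain ⟨v, hv, rfl⟩ := Finset.mem_image.1 hw
        have hs := Φ.size_pos u
        refine le_trans ?_ (Φ.le_size_append u v)
        calc b * δ = Φ.size u / Φ.K * (b * (δ / (Φ.size u / Φ.K))) := by field_simp
          _ ≤ _ := mul_le_mul_of_nonneg_left (hWs u hu v hv) (by positivity)
      · rw [Finset.card_biUnion]
        · push_cast
          calc δ ^ (-t) ≤ δ ^ (-t) * ∑ u ∈ B, (Φ.size u / Φ.K) ^ t :=
                le_mul_of_one_le_right (by positivity) hB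
            _ = ∑ u ∈ B, (δ / (Φ.size u / Φ.K)) ^ (-t) := by
                rw [Finset.mul_sum]
                refine Finset.sum_congr rfl fun u _ => ?_
                have ha : 0 < Φ.size u / Φ.K := div_pos (Φ.size_pos u) hK
                rw [Real.div_rpow hδ0.le ha.le, Real.rpow_neg ha.le, div_inv_eq_mul]
            _ ≤ _ := by
                refine Finset.sum_le_sum fun u hu => (hWc u hu).trans ?_
                rw [Finset.card_image_of_injective _ (List.append_right_injective u)]
        · intro u hu u' hu' huu
          rw [Function.onFun, Finset.disjoint_left]
          rintro w hw hw'
          obtain ⟨v, -, rfl⟩ := Finset.mem_image.1 hw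
          obtain ⟨v', -, hv'⟩ := Finset.mem_image.1 hw'
          exact huu (List.append_inj_left hv' ((hlen u' hu').trans (hlen u hu).symm)).symm
  refine ⟨b, hb0, fun δ hδ hδ1 => ?_⟩
  obtain ⟨k, hk⟩ := exists_pow_lt_of_lt_one hδ Φ.hc1
  exact hind k δ hk.le (hδ1.trans ((one_le_div hb0).2 hb1))

theorem exists_le_coveringNumber_limitSet {t : ℝ} (ht : 0 ≤ t)
    (hth : t = 0 ∨ t < (dimH Φ.limitSet).toReal) :
    ∃ C : ℝ, 0 < C ∧ ∀ r ρ : ℝ, 0 < r → r ≤ ρ → ρ < 1 →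
      (ρ / r) ^ t * _root_.coveringNumber Φ.fixedPoints ρ ≤
        C * _root_.coveringNumber Φ.limitSet r := by
  classical
  obtain ⟨b, hb, hW⟩ := Φ.exists_pairwiseDisjoint_cylinders ht hth
  obtain ⟨C, hC⟩ := Φ.exists_card_le_of_pairwiseDisjoint (M := 2 / b) (by positivity)
  refine ⟨⌊C⌋₊ + 1, by positivity, fun r ρ hr hrρ hρ => ?_⟩
  have hρ0 : 0 < ρ := hr.trans_le hrρ
  obtain ⟨W, hWd, hWs, hWc⟩ := hW (r / ρ) (div_pos hr hρ0) ((div_le_one hρ0).2 hrρ)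
  obtain ⟨P, hPF, hPs, hPc⟩ := exists_separated_card_ge
    (Φ.totallyBounded_X.subset Φ.fixedPoints_subset) hρ0
  obtain ⟨Q, hQc, hQ⟩ := exists_cover_card_eq_coveringNumber
    (Φ.totallyBounded_X.subset Φ.limitSet_subset) hr
  have hex : ∀ j ∈ W ×ˢ P, ∃ q ∈ Q, dist (compMaps Φ.S j.1 j.2) q ≤ r := by
    intro j hj
    have hp := Φ.fixedPoints_subset_limitSet (hPF (Finset.mem_product.1 hj).2)
    obtain ⟨q, hq, hjq⟩ := mem_iUnion₂.1 (hQ (Φ.compMaps_S_mapsTo_limitSet j.1 hp))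
    exact ⟨q, hq, (mem_ball.1 hjq).le⟩
  choose! f hfQ hf using hex
  have hsize : ∀ w ∈ W, b * r / 2 < Φ.size w := by
    intro w hw
    refine lt_of_lt_of_le ?_ (hWs w hw)
    rw [mul_div_assoc]
    exact mul_lt_mul_of_pos_left (div_lt_div_of_pos_left hr hρ0 (by linarith)) hb
  have hrad : ∀ w ∈ W, b * r / 2 / Φ.size w ≤ ρ / 2 := by
    intro w hw
    rw [div_le_iff₀ (Φ.size_pos w)]
    calc b * r / 2 = ρ / 2 * (b * (r / ρ)) := by field_simp
      _ ≤ _ := mul_le_mul_of_nonneg_left (hWs w hw) (by positivity)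
  have hcard : (W ×ˢ P).card ≤ ⌊C⌋₊ * Q.card := by
    refine Finset.card_le_mul_card_image_of_maps_to (f := f) hfQ _ fun q _ => Nat.le_floor ?_
    have hmem : ∀ j ∈ (W ×ˢ P).filter (fun j => f j = q), j.1 ∈ W ∧ j.2 ∈ P ∧ f j = q ∧
        j ∈ W ×ˢ P := fun j hj => by
      have h := Finset.mem_filter.1 hj
      exact ⟨(Finset.mem_product.1 h.1).1, (Finset.mem_product.1 h.1).2, h.2, h.1⟩
    refine hC _ Prod.fst Prod.snd q (b * r / 2) (by positivity)
      (fun j hj => Φ.fixedPoints_subset (hPF (hmem j hj).2.1)) (fun j hj => hsize _ (hmem j hj).1)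
      ?_ fun j hj => ?_
    · rintro ⟨w, p⟩ hj ⟨w', p'⟩ hj' hne
      obtain ⟨hw, hp, -⟩ := hmem _ hj
      obtain ⟨hw', hp', -⟩ := hmem _ hj'
      simp only [Function.onFun]
      by_cases hww : w = w'
      · subst hww
        have hpp : p ≠ p' := fun h => hne (by rw [h])
        refine (Φ.compMaps_T_injOn w).disjoint_image
          (inter_subset_right.trans Φ.interior_subset_V)
          (inter_subset_right.trans Φ.interior_subset_V) ?_
        refine (ball_disjoint_ball ?_).mono inter_subset_left inter_subset_left
        linarith [hPs hp hp' hpp, hrad w hw]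
      · exact (hWd hw hw' hww).mono (image_mono inter_subset_right) (image_mono inter_subset_right)
    · obtain ⟨-, -, hq, hj⟩ := hmem j hj
      have := hf j hj
      rw [hq] at this
      rwa [show 2 / b * (b * r / 2) = r by field_simp]
  rw [Finset.card_product, hQc] at hcard
  rw [Real.rpow_neg (by positivity), ← Real.inv_rpow (by positivity), inv_div] at hWc
  calc (ρ / r) ^ t * _root_.coveringNumber Φ.fixedPoints ρ ≤ W.card * P.card := by
        gcongr
    _ ≤ ⌊C⌋₊ * _root_.coveringNumber Φ.limitSet r := by exact_mod_cast hcard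
    _ ≤ _ := mul_le_mul_of_nonneg_right (by linarith) (by positivity)

end CIFS

theorem liminf_eq_liminf_of_tendsto_sub {α : Type*} {l : Filter α} {f g : α → ℝ}
    (h : Tendsto (fun x => f x - g x) l (𝓝 0)) : liminf f l = liminf g l := by
  have key : ∀ {f g : α → ℝ}, Tendsto (fun x => f x - g x) l (𝓝 0) → ∀ a : ℝ,
      (∀ᶠ x in l, a ≤ f x) → ∀ ε : ℝ, 0 < ε → ∀ᶠ x in l, a - ε ≤ g x := by
    intro f g h a ha ε hε
    filter_upwards [ha, h.eventually_lt_const hε] with x h1 h2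
    linarith
  have h' : Tendsto (fun x => g x - f x) l (𝓝 0) := by simpa using h.neg
  have hle : ∀ {f g : α → ℝ}, Tendsto (fun x => f x - g x) l (𝓝 0) →
      {a | ∀ᶠ x in l, a ≤ f x}.Nonempty → BddAbove {a | ∀ᶠ x in l, a ≤ g x} →
      sSup {a | ∀ᶠ x in l, a ≤ f x} ≤ sSup {a | ∀ᶠ x in l, a ≤ g x} := by
    intro f g h hne hbdd
    refine csSup_le hne fun a ha => le_of_forall_pos_le_add fun ε hε => ?_
    have : a - ε ≤ sSup {a | ∀ᶠ x in l, a ≤ g x} := le_csSup hbdd (key h a ha ε hε)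
    linarith
  have hne : ∀ {f g : α → ℝ}, Tendsto (fun x => f x - g x) l (𝓝 0) →
      {a | ∀ᶠ x in l, a ≤ f x}.Nonempty → {a | ∀ᶠ x in l, a ≤ g x}.Nonempty :=
    fun h ⟨a, ha⟩ => ⟨a - 1, key h a ha 1 one_pos⟩
  have hbd : ∀ {f g : α → ℝ}, Tendsto (fun x => f x - g x) l (𝓝 0) →
      BddAbove {a | ∀ᶠ x in l, a ≤ g x} → BddAbove {a | ∀ᶠ x in l, a ≤ f x} := by
    rintro f g h ⟨M, hM⟩
    refine ⟨M + 1, fun a ha => ?_⟩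
    have := hM (key h a ha 1 one_pos)
    linarith
  rw [liminf_eq, liminf_eq]
  by_cases hn : {a | ∀ᶠ x in l, a ≤ f x}.Nonempty
  · by_cases hb : BddAbove {a | ∀ᶠ x in l, a ≤ f x}
    · exact le_antisymm (hle h hn (hbd h' hb)) (hle h' (hne h hn) hb)
    · rw [Real.sSup_of_not_bddAbove hb, Real.sSup_of_not_bddAbove fun hb' => hb (hbd h hb')]
  · rw [not_nonempty_iff_eq_empty.1 hn,
      not_nonempty_iff_eq_empty.1 fun hn' => hn (hne h' hn')]

namespace CIFS

variable {d : ℕ} (Φ : CIFS d)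

theorem Psi_mul_log {r θ : ℝ} (hr : 0 < r) (hr1 : r < 1) (hθ : 0 < θ) :
    Φ.Psi r θ * Real.log (1 / r) = (1 - θ) * (dimH Φ.limitSet).toReal * Real.log (1 / r) +
      Real.log (_root_.coveringNumber Φ.fixedPoints (r ^ θ)) := by
  have hL : 0 < Real.log (1 / r) := Real.log_pos ((one_lt_div hr).2 hr1)
  have h1 : Real.log (1 / r ^ θ) = θ * Real.log (1 / r) := by
    rw [one_div, one_div, Real.log_inv, Real.log_inv, Real.log_rpow hr, mul_neg]
  rw [Psi, sFun, h1]
  field_simp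

theorem one_le_coveringNumber_fixedPoints {r : ℝ} (hr : 0 < r) :
    (1 : ℝ) ≤ _root_.coveringNumber Φ.fixedPoints r := by
  exact_mod_cast one_le_coveringNumber (Φ.totallyBounded_X.subset Φ.fixedPoints_subset)
    Φ.fixedPoints_nonempty hr

theorem one_le_coveringNumber_limitSet {r : ℝ} (hr : 0 < r) :
    (1 : ℝ) ≤ _root_.coveringNumber Φ.limitSet r := by
  exact_mod_cast one_le_coveringNumber (Φ.totallyBounded_X.subset Φ.limitSet_subset)
    (Φ.fixedPoints_nonempty.mono Φ.fixedPoints_subset_limitSet) hr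

theorem bddAbove_Psi {r : ℝ} (hr : 0 < r) (hr1 : r < 1) : BddAbove (Φ.Psi r '' Ioc 0 1) := by
  have hL : 0 < Real.log (1 / r) := Real.log_pos ((one_lt_div hr).2 hr1)
  refine ⟨(dimH Φ.limitSet).toReal +
    Real.log (_root_.coveringNumber Φ.fixedPoints r) / Real.log (1 / r), ?_⟩
  rintro _ ⟨θ, ⟨hθ0, hθ1⟩, rfl⟩
  have h1 : r ≤ r ^ θ := by
    simpa using Real.rpow_le_rpow_of_exponent_ge hr hr1.le hθ1
  have h2 := coveringNumber_anti (Φ.totallyBounded_X.subset Φ.fixedPoints_subset) hr h1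
  have h3 : Real.log (_root_.coveringNumber Φ.fixedPoints (r ^ θ)) ≤
      Real.log (_root_.coveringNumber Φ.fixedPoints r) :=
    Real.log_le_log (zero_lt_one.trans_le (Φ.one_le_coveringNumber_fixedPoints (hr.trans_le h1)))
      (by exact_mod_cast h2)
  rw [← mul_le_mul_iff_left₀ hL, Φ.Psi_mul_log hr hr1 hθ0, add_mul, div_mul_cancel₀ _ hL.ne']
  refine add_le_add (mul_le_mul_of_nonneg_right ?_ hL.le) h3
  exact mul_le_of_le_one_left ENNReal.toReal_nonneg (by linarith)

variable [NeZero d]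

theorem exists_sFun_limitSet_le :
    ∃ C : ℝ, ∀ r : ℝ, 0 < r → r < 1 → sFun Φ.limitSet r - Φ.psi r ≤
      (C + 2 * Real.log (Real.log (1 / r) + 1)) / Real.log (1 / r) := by
  obtain ⟨C, hC, h⟩ := Φ.exists_coveringNumber_limitSet_le
  refine ⟨Real.log C, fun r hr hr1 => ?_⟩
  have hlogr : Real.log r < 0 := Real.log_neg hr hr1
  have hL : 0 < Real.log (1 / r) := Real.log_pos ((one_lt_div hr).2 hr1)
  have h1 := h r hr hr1 (Real.exp (Φ.psi r * Real.log (1 / r))) (Real.exp_pos _).le ?_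
  · have h2 := Real.log_le_log (zero_lt_one.trans_le (Φ.one_le_coveringNumber_limitSet hr)) h1
    rw [Real.log_mul (by positivity) (by positivity), Real.log_mul (by positivity) (by positivity),
      Real.log_exp, Real.log_pow] at h2
    push_cast at h2
    rw [sub_le_iff_le_add, sFun, div_add' _ _ _ hL.ne']
    exact div_le_div_of_nonneg_right (by linarith) hL.le
  · intro ρ hrρ hρ
    have hρ0 : 0 < ρ := hr.trans_le hrρ
    have hlog : Real.log r ≤ Real.log ρ := Real.log_le_log hr hrρ
    have hlogρ : Real.log ρ < 0 := Real.log_neg hρ0 hρ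
    have hθ : Real.log ρ / Real.log r ∈ Ioc (0 : ℝ) 1 :=
      ⟨div_pos_of_neg_of_neg hlogρ hlogr, (div_le_one_of_neg hlogr).2 hlog⟩
    have hpow : r ^ (Real.log ρ / Real.log r) = ρ := by
      rw [Real.rpow_def_of_pos hr, mul_div_cancel₀ _ hlogr.ne, Real.exp_log hρ0]
    have h3 : Φ.Psi r (Real.log ρ / Real.log r) ≤ Φ.psi r :=
      le_csSup (Φ.bddAbove_Psi hr hr1) (mem_image_of_mem _ hθ)
    have h4 := mul_le_mul_of_nonneg_right h3 hL.le
    rw [Φ.Psi_mul_log hr hr1 hθ.1, hpow] at h4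
    have hN := Φ.one_le_coveringNumber_fixedPoints hρ0
    rw [Real.rpow_def_of_pos (div_pos hr hρ0), ← Real.exp_add,
      ← Real.log_le_iff_le_exp (zero_lt_one.trans_le hN), Real.log_div hr.ne' hρ0.ne']
    have h5 : (1 - Real.log ρ / Real.log r) * (dimH Φ.limitSet).toReal * Real.log (1 / r) =
        -((Real.log r - Real.log ρ) * (dimH Φ.limitSet).toReal) := by
      rw [one_div, Real.log_inv]
      field_simp [hlogr.ne]
    linarith

theorem exists_le_sFun_limitSet {ε : ℝ} (hε : 0 < ε) :
    ∃ C : ℝ, ∀ r : ℝ, 0 < r → r < 1 →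
      Φ.psi r - sFun Φ.limitSet r ≤ ε + C / Real.log (1 / r) := by
  set h := (dimH Φ.limitSet).toReal
  have hth : max (h - ε) 0 = 0 ∨ max (h - ε) 0 < h := by
    rcases le_or_gt (h - ε) 0 with hle | hlt
    · exact Or.inl (max_eq_right hle)
    · right
      rw [max_eq_left hlt.le]
      linarith
  obtain ⟨C, hC, hlow⟩ := Φ.exists_le_coveringNumber_limitSet (le_max_right _ _) hth
  refine ⟨Real.log C, fun r hr hr1 => ?_⟩
  have hL : 0 < Real.log (1 / r) := Real.log_pos ((one_lt_div hr).2 hr1)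
  rw [sub_le_iff_le_add]
  refine csSup_le ⟨_, mem_image_of_mem _ ⟨one_pos, le_rfl⟩⟩ ?_
  rintro _ ⟨θ, ⟨hθ0, hθ1⟩, rfl⟩
  have hρ0 : 0 < r ^ θ := Real.rpow_pos_of_pos hr θ
  have h1 : r ≤ r ^ θ := by
    simpa using Real.rpow_le_rpow_of_exponent_ge hr hr1.le hθ1
  have h2 := hlow r (r ^ θ) hr h1 (Real.rpow_lt_one hr.le hr1 hθ0)
  have hF := zero_lt_one.trans_le (Φ.one_le_coveringNumber_fixedPoints hρ0)
  have hΛ := zero_lt_one.trans_le (Φ.one_le_coveringNumber_limitSet hr)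
  have h3 := Real.log_le_log (by positivity) h2
  rw [Real.log_mul (by positivity) hF.ne', Real.log_mul hC.ne' hΛ.ne',
    Real.log_rpow (by positivity), Real.log_div hρ0.ne' hr.ne', Real.log_rpow hr] at h3
  have h4 : θ * Real.log r - Real.log r = (1 - θ) * Real.log (1 / r) := by
    rw [one_div, Real.log_inv]
    ring
  rw [h4] at h3
  have h5 : 0 ≤ (1 - θ) * Real.log (1 / r) := mul_nonneg (by linarith) hL.le
  have h6 := mul_le_mul_of_nonneg_right (le_max_left (h - ε) 0) h5
  have h7 : ε * ((1 - θ) * Real.log (1 / r)) ≤ ε * Real.log (1 / r) :=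
    mul_le_mul_of_nonneg_left (mul_le_of_le_one_left hL.le (by linarith)) hε.le
  rw [← mul_le_mul_iff_left₀ hL, Φ.Psi_mul_log hr hr1 hθ0, sFun, add_mul, add_mul,
    div_mul_cancel₀ _ hL.ne', div_mul_cancel₀ _ hL.ne']
  linarith

theorem tendsto_sFun_sub_psi :
    Tendsto (fun r => sFun Φ.limitSet r - Φ.psi r) (𝓝[>] 0) (𝓝 0) := by
  have hlog : Tendsto (fun r : ℝ => Real.log (1 / r)) (𝓝[>] 0) atTop := by
    simp only [one_div]
    exact Real.tendsto_log_atTop.comp tendsto_inv_nhdsGT_zero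
  have hconst : ∀ C : ℝ, Tendsto (fun r : ℝ => C / Real.log (1 / r)) (𝓝[>] 0) (𝓝 0) :=
    fun C => hlog.const_div_atTop C
  have hloglog : Tendsto (fun x : ℝ => Real.log (x + 1) / x) atTop (𝓝 0) := by
    have := (Real.tendsto_pow_log_div_mul_add_atTop 1 (-1) 1 one_ne_zero).comp
      (tendsto_atTop_add_const_right atTop (1 : ℝ) tendsto_id)
    simpa [Function.comp_def] using this
  have hunit : ∀ᶠ r : ℝ in 𝓝[>] 0, 0 < r ∧ r < 1 :=
    Ioo_mem_nhdsGT one_pos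
  obtain ⟨C, hC⟩ := Φ.exists_sFun_limitSet_le
  have hup : Tendsto (fun r : ℝ => (C + 2 * Real.log (Real.log (1 / r) + 1)) / Real.log (1 / r))
      (𝓝[>] 0) (𝓝 0) := by
    have := (hconst C).add ((hloglog.comp hlog).const_mul 2)
    rw [mul_zero, add_zero] at this
    refine this.congr fun r => ?_
    simp only [Function.comp_apply]
    ring
  refine tendsto_order.2 ⟨fun a ha => ?_, fun a ha => ?_⟩
  · obtain ⟨C', hC'⟩ := Φ.exists_le_sFun_limitSet (ε := -a / 2) (by linarith)
    filter_upwards [hunit, (hconst C').eventually_lt_const (u := -a / 2) (by linarith)]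
      with r hr hlt
    linarith [hC' r hr.1 hr.2]
  · filter_upwards [hunit, hup.eventually_lt_const ha] with r hr hlt
    exact (hC r hr.1 hr.2).trans_lt hlt

end CIFS

/-- Asymptotic formula for the covering numbers of the limit set:
`log N_r(Λ)/log(1/r) - ψ(r) → 0` as `r → 0⁺`; in particular
`dim_LB Λ = liminf_{r→0} ψ(r)`. -/
theorem covering_asymptotic_formula {d : ℕ} (hd : 1 ≤ d) (Phi : CIFS d) :
    Filter.Tendsto (fun r => sFun Phi.limitSet r - Phi.psi r)
      (nhdsWithin (0 : ℝ) (Set.Ioi 0)) (nhds 0) ∧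
    dimLB Phi.limitSet = Filter.liminf Phi.psi (nhdsWithin (0 : ℝ) (Set.Ioi 0)) := by
  have : NeZero d := ⟨by omega⟩
  have h := Phi.tendsto_sFun_sub_psi
  exact ⟨h, liminf_eq_liminf_of_tendsto_sub h⟩

end
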